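/- Let n ≤ 3, let K be an n-dimensional geometric simplicial complex in ℝ^n, let A be a simplex of K whose star st(A,K) is disjoint from the topological boundary of |K| in ℝ^n, and let a be a point in the interior of A. Then the stellar subdivision (A,a)K is related to K by a finite sequence of geometric bistellar moves. -/

import Mathlib

open Set
open scoped Classical

variable {E : Type*} [NormedAddCommGroup E] [NormedSpace ℝ E]

/-- `K'` is a subdivision of `K`: same support, and every simplex of `K'` is contained in
some simplex of `K`. -/
def IsSubdivision (K' K : Geometry.SimplicialComplex ℝ E) : Prop :=
  K'.space = K.space ∧
    ∀ s ∈ K'.faces, ∃ t ∈ K.faces, convexHull ℝ (s : Set E) ⊆ convexHull ℝ (t : Set E)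

/-- `K'` is a derived subdivision of `K`: for each simplex `A` of `K` an interior point `b A`
(in the relative interior of its convex hull; for a vertex this forces `b {x} = x`) is chosen,
and the simplices of `K'` are exactly the convex hulls of the sets `{b A₀, …, b Aₖ}` for chains
`A₀ ⊊ ⋯ ⊊ Aₖ` of simplices of `K`. -/
def IsDerivedSubdivision (K' K : Geometry.SimplicialComplex ℝ E) : Prop :=
  ∃ b : Finset E → E,
    (∀ s ∈ K.faces, b s ∈ intrinsicInterior ℝ (convexHull ℝ (s : Set E))) ∧
    K'.faces = {S | ∃ T : Finset (Finset E), ↑T ⊆ K.faces ∧ T.Nonempty ∧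
      (∀ A ∈ T, ∀ B ∈ T, A ⊆ B ∨ B ⊆ A) ∧ S = T.image b}

/-- `K'` is an `s`-fold iterated derived subdivision of `K`. -/
def IsIterDerived : ℕ → Geometry.SimplicialComplex ℝ E → Geometry.SimplicialComplex ℝ E → Prop
  | 0, K', K => K' = K
  | (s + 1), K', K => ∃ K'', IsIterDerived s K'' K ∧ IsDerivedSubdivision K' K''

/-- The geometric bistellar move `κ(A,B)` on an `n`-dimensional complex: `A` is a simplex of `K`,
`B` is a simplex not in `K` with `dim A + dim B = n` (i.e. `card A + card B = n + 2`), the link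
of `A` in `K` is the boundary complex of `B`, and `K'` is obtained from `K` by replacing
`A ⋆ ∂B` (the simplices containing `A`) with `∂A ⋆ B`; the result is again a geometric
simplicial complex with the same support. -/
def BistellarMove (n : ℕ) (K K' : Geometry.SimplicialComplex ℝ E) : Prop :=
  ∃ A B : Finset E, A ∈ K.faces ∧ B ∉ K.faces ∧ B.Nonempty ∧
    A.card + B.card = n + 2 ∧
    {C : Finset E | C.Nonempty ∧ Disjoint A C ∧ A ∪ C ∈ K.faces} =
      {C : Finset E | C.Nonempty ∧ C ⊂ B} ∧
    K'.faces = (K.faces \ {s | A ⊆ s}) ∪ {s | ∃ A' : Finset E, A' ⊂ A ∧ s = A' ∪ B} ∧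
    K'.space = K.space

/-- `h` is a regular function for the triangulation `K` of a flat `d`-dimensional polyhedron:
it is affine on each simplex of `K` and strictly convex across each codimension-one simplex,
i.e. for `x`, `y` in distinct `d`-simplices sharing a common `(d-1)`-face, the open segment
from `(x, h x)` to `(y, h y)` lies strictly above the graph of `h`. -/
def IsRegularFunction (d : ℕ) (K : Geometry.SimplicialComplex ℝ E) (h : E → ℝ) : Prop :=
  (∀ s ∈ K.faces, ∃ g : E →ᵃ[ℝ] ℝ, ∀ x ∈ convexHull ℝ (s : Set E), h x = g x) ∧
  (∀ σ ∈ K.faces, ∀ σ' ∈ K.faces, σ ≠ σ' → σ.card = d + 1 → σ'.card = d + 1 →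
    (σ ∩ σ').card = d →
    ∀ x ∈ convexHull ℝ (σ : Set E), ∀ y ∈ convexHull ℝ (σ' : Set E),
      ∀ t : ℝ, t ∈ Set.Ioo (0 : ℝ) 1 → (1 - t) • x + t • y ∈ K.space →
        h ((1 - t) • x + t • y) < (1 - t) * h x + t * h y)

/-- `K` is a regular triangulation (of a flat `d`-dimensional polyhedron). -/
def IsRegularTriangulation (d : ℕ) (K : Geometry.SimplicialComplex ℝ E) : Prop :=
  ∃ h : E → ℝ, IsRegularFunction d K h

/-- `P` is strictly star-convex: there is an interior point `x` such that for every `y ∈ P`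
the open segment from `x` to `y` lies in the interior of `P`. -/
def StrictlyStarConvex (P : Set E) : Prop :=
  ∃ x ∈ interior P, ∀ y ∈ P, ∀ t ∈ Set.Ioo (0 : ℝ) 1, (1 - t) • x + t • y ∈ interior P

set_option linter.unusedSectionVars false

section BarycentricWeights

/-- The homogeneous barycentric map: a finitely supported weight `w` on the points of `E` is sent
to the pair `(∑ w v • v, ∑ w v)`. -/
noncomputable def bary : (E →₀ ℝ) →ₗ[ℝ] E × ℝ :=
  Finsupp.linearCombination ℝ (fun v : E => (v, (1 : ℝ)))

/-- The weight `w` vanishes outside of `s`. -/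
def SuppIn (w : E →₀ ℝ) (s : Finset E) : Prop := ∀ v, v ∉ s → w v = 0

/-- The weight `w` is nonnegative. -/
def WNonneg (w : E →₀ ℝ) : Prop := ∀ v, 0 ≤ w v

lemma bary_single (p : E) (r : ℝ) : bary (Finsupp.single p r) = (r • p, r) := by
  simp [bary]

lemma bary_eq_sum {w : E →₀ ℝ} {s : Finset E} (h : SuppIn w s) :
    bary w = (∑ v ∈ s, w v • v, ∑ v ∈ s, w v) := by
  rw [bary, Finsupp.linearCombination_apply, Finsupp.sum_of_support_subset (s := s)]
  · ext
    · simp [Prod.fst_sum]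
    · simp [Prod.snd_sum]
  · intro v hv
    by_contra hvs
    exact (Finsupp.mem_support_iff.mp hv) (h v hvs)
  · simp

lemma SuppIn.mono {w : E →₀ ℝ} {s t : Finset E} (h : SuppIn w s) (hst : s ⊆ t) : SuppIn w t :=
  fun v hv => h v (fun hvs => hv (hst hvs))

/-- The weight on `s` with prescribed values. -/
noncomputable def weightOn (s : Finset E) (f : E → ℝ) : E →₀ ℝ :=
  Finsupp.onFinset s (fun v => if v ∈ s then f v else 0) (by intro v; simp; tauto)

lemma weightOn_apply (s : Finset E) (f : E → ℝ) (v : E) :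
    weightOn s f v = if v ∈ s then f v else 0 := rfl

lemma suppIn_weightOn (s : Finset E) (f : E → ℝ) : SuppIn (weightOn s f) s := by
  intro v hv
  simp [weightOn_apply, hv]

lemma mem_convexHull_iff_bary {s : Finset E} {z : E} :
    z ∈ convexHull ℝ (s : Set E) ↔ ∃ w : E →₀ ℝ, SuppIn w s ∧ WNonneg w ∧ bary w = (z, 1) := by
  rw [Finset.mem_convexHull']
  constructor
  · rintro ⟨w, h0, h1, h2⟩
    refine ⟨weightOn s w, suppIn_weightOn _ _, ?_, ?_⟩
    · intro v
      rw [weightOn_apply]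
      split_ifs with h
      · exact h0 v h
      · exact le_rfl
    · rw [bary_eq_sum (suppIn_weightOn s w)]
      simp only [weightOn_apply]
      ext
      · simp only
        rw [← h2]
        exact Finset.sum_congr rfl (fun v hv => by simp [hv])
      · simp only
        rw [← h1]
        exact Finset.sum_congr rfl (fun v hv => by simp [hv])
  · rintro ⟨w, hs, h0, h1⟩
    rw [bary_eq_sum hs, Prod.mk.injEq] at h1
    exact ⟨w, fun y _ => h0 y, h1.2, h1.1⟩

lemma eq_zero_of_bary_eq_zero {s : Finset E} (hs : AffineIndependent ℝ ((↑) : s → E))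
    {f : E →₀ ℝ} (hf : SuppIn f s) (h : bary f = 0) : f = 0 := by
  rw [bary_eq_sum hf, Prod.mk_eq_zero] at h
  rw [affineIndependent_iff] at hs
  have := hs Finset.univ (fun v => f v)
    (by rw [← h.2]; exact (Finset.sum_coe_sort s (fun v => f v)))
    (by rw [← h.1]; exact (Finset.sum_coe_sort s (fun v => f v • v)))
  ext v
  by_cases hv : v ∈ s
  · exact this ⟨v, hv⟩ (Finset.mem_univ _)
  · exact hf v hv

lemma eq_of_bary_eq {s : Finset E} (hs : AffineIndependent ℝ ((↑) : s → E))
    {f g : E →₀ ℝ} (hf : SuppIn f s) (hg : SuppIn g s) (h : bary f = bary g) : f = g := by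
  have : f - g = 0 := eq_zero_of_bary_eq_zero hs (fun v hv => by simp [hf v hv, hg v hv])
    (by rw [map_sub, h, sub_self])
  exact sub_eq_zero.mp this

lemma affineIndependent_of_bary {s : Finset E}
    (h : ∀ f : E →₀ ℝ, SuppIn f s → bary f = 0 → f = 0) :
    AffineIndependent ℝ ((↑) : s → E) := by
  rw [affineIndependent_iff]
  intro t w h0 h1 e he
  have key := h (∑ i ∈ t, Finsupp.single (i : E) (w i)) ?_ ?_
  · have := DFunLike.congr_fun key (e : E)
    rw [Finsupp.finsetSum_apply, Finset.sum_eq_single e] at this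
    · simpa using this
    · intro b _ hb
      rw [Finsupp.single_apply, if_neg]
      exact fun h => hb (Subtype.ext h)
    · intro h; exact absurd he h
  · intro v hv
    rw [Finsupp.finsetSum_apply]
    refine Finset.sum_eq_zero fun i _ => ?_
    rw [Finsupp.single_apply, if_neg]
    rintro rfl
    exact hv i.2
  · rw [map_sum]
    simp only [bary_single]
    ext
    · simpa [Prod.fst_sum] using h1
    · simpa [Prod.snd_sum] using h0

lemma exists_weight_of_card {s : Finset E} [FiniteDimensional ℝ E]
    (hs : AffineIndependent ℝ ((↑) : s → E)) (hc : s.card = Module.finrank ℝ E + 1) :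
    ∃ B : (E × ℝ) →ₗ[ℝ] (E →₀ ℝ), ∀ y, SuppIn (B y) s ∧ bary (B y) = y := by
  let L : (s → ℝ) →ₗ[ℝ] (E →₀ ℝ) :=
    ∑ i : s, (Finsupp.lsingle (i : E)).comp (LinearMap.proj i)
  have hL : ∀ f, SuppIn (L f) s := by
    intro f v hv
    simp only [L, LinearMap.sum_apply, LinearMap.comp_apply, LinearMap.proj_apply,
      Finsupp.lsingle_apply, Finsupp.finsetSum_apply]
    refine Finset.sum_eq_zero fun i _ => ?_
    rw [Finsupp.single_apply, if_neg]
    rintro rfl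
    exact hv i.2
  have hL' : ∀ f (i : s), L f i = f i := by
    intro f i
    simp only [L, LinearMap.sum_apply, LinearMap.comp_apply, LinearMap.proj_apply,
      Finsupp.lsingle_apply, Finsupp.finsetSum_apply]
    rw [Finset.sum_eq_single i]
    · simp
    · intro b _ hb
      rw [Finsupp.single_apply, if_neg]
      exact fun h => hb (Subtype.ext h)
    · simp
  have hinj : Function.Injective (bary.comp L) := by
    intro f g hfg
    have := eq_of_bary_eq hs (hL f) (hL g) hfg
    ext i
    rw [← hL' f, ← hL' g, this]
  have hfr : Module.finrank ℝ (s → ℝ) = Module.finrank ℝ (E × ℝ) := by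
    simp [hc]
  let e := LinearEquiv.ofInjectiveOfFinrankEq (bary.comp L) hinj hfr
  refine ⟨L.comp e.symm.toLinearMap, fun y => ⟨hL _, ?_⟩⟩
  exact e.apply_symm_apply y

lemma card_le_of_affineIndependent {s : Finset E} [FiniteDimensional ℝ E]
    (hs : AffineIndependent ℝ ((↑) : s → E)) : s.card ≤ Module.finrank ℝ E + 1 := by
  have := hs.card_le_finrank_succ
  rw [Fintype.card_coe] at this
  exact this.trans (Nat.add_le_add_right (Submodule.finrank_le _) 1)

end BarycentricWeights

section Complexes

variable {K : Geometry.SimplicialComplex ℝ E}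

lemma mem_space_iff_bary {z : E} : z ∈ K.space ↔
    ∃ s ∈ K.faces, ∃ w : E →₀ ℝ, SuppIn w s ∧ WNonneg w ∧ bary w = (z, 1) := by
  simp_rw [Geometry.SimplicialComplex.mem_space_iff, mem_convexHull_iff_bary]

lemma bary_snd {w : E →₀ ℝ} {s : Finset E} (h : SuppIn w s) :
    (bary w).2 = ∑ v ∈ s, w v := by
  rw [bary_eq_sum h]

lemma eq_zero_of_bary_snd {w : E →₀ ℝ} {s : Finset E} (h : SuppIn w s) (h0 : WNonneg w)
    (h1 : (bary w).2 = 0) : w = 0 := by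
  rw [bary_snd h, Finset.sum_eq_zero_iff_of_nonneg (fun v _ => h0 v)] at h1
  ext v
  by_cases hv : v ∈ s
  · exact h1 v hv
  · exact h v hv

/-- Nonnegative weights on faces of a simplicial complex are determined by the point they
represent. -/
lemma weights_unique {s t : Finset E} (hs : s ∈ K.faces) (ht : t ∈ K.faces) {f g : E →₀ ℝ}
    (hf : SuppIn f s) (hf0 : WNonneg f) (hg : SuppIn g t) (hg0 : WNonneg g)
    (h : bary f = bary g) : f = g := by
  set r := (bary f).2 with hr
  by_cases hr0 : r = 0
  · rw [eq_zero_of_bary_snd hf hf0 (hr ▸ hr0), eq_zero_of_bary_snd hg hg0 (by rw [← h, ← hr, hr0])]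
  have hrpos : 0 < r := by
    refine lt_of_le_of_ne ?_ (Ne.symm hr0)
    rw [hr, bary_snd hf]
    exact Finset.sum_nonneg (fun v _ => hf0 v)
  have hb : bary (r⁻¹ • f) = (r⁻¹ • (bary f).1, 1) := by
    rw [map_smul]
    ext
    · simp
    · simp [← hr, hr0]
  have hb' : bary (r⁻¹ • g) = (r⁻¹ • (bary f).1, 1) := by rw [← hb, map_smul, map_smul, h]
  have hfs : SuppIn (r⁻¹ • f) s := fun v hv => by simp [hf v hv]
  have hgt : SuppIn (r⁻¹ • g) t := fun v hv => by simp [hg v hv]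
  have m1 : r⁻¹ • (bary f).1 ∈ convexHull ℝ (s : Set E) :=
    mem_convexHull_iff_bary.mpr ⟨_, hfs, fun v => by
      simpa using mul_nonneg (inv_nonneg.mpr hrpos.le) (hf0 v), hb⟩
  have m2 : r⁻¹ • (bary f).1 ∈ convexHull ℝ (t : Set E) :=
    mem_convexHull_iff_bary.mpr ⟨_, hgt, fun v => by
      simpa using mul_nonneg (inv_nonneg.mpr hrpos.le) (hg0 v), hb'⟩
  have m3 := K.inter_subset_convexHull hs ht ⟨m1, m2⟩
  rw [← Finset.coe_inter, mem_convexHull_iff_bary] at m3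
  obtain ⟨w, hw, -, hw1⟩ := m3
  have e1 := eq_of_bary_eq (K.indep hs) hfs (hw.mono Finset.inter_subset_left) (hb.trans hw1.symm)
  have e2 := eq_of_bary_eq (K.indep ht) hgt (hw.mono Finset.inter_subset_right)
    (hb'.trans hw1.symm)
  have := e1.trans e2.symm
  exact smul_right_injective _ (inv_ne_zero hr0) this

/-- A family of finite sets such that nonnegative weights on its members are determined by the
represented point is a simplicial complex. -/
noncomputable def complexOfUnique (F : Set (Finset E))
    (hF : IsRelLowerSet F Finset.Nonempty)
    (hU : ∀ s ∈ F, ∀ t ∈ F, ∀ f g : E →₀ ℝ, SuppIn f s → WNonneg f → SuppIn g t → WNonneg g →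
      bary f = bary g → f = g) : Geometry.SimplicialComplex ℝ E where
  faces := F
  isRelLowerSet_faces := hF
  indep {s} hs := by
    refine affineIndependent_of_bary fun f hf h => ?_
    have key := hU s hs s hs (weightOn s fun v => max (f v) 0) (weightOn s fun v => max (-f v) 0)
      (suppIn_weightOn _ _) (fun v => by rw [weightOn_apply]; split_ifs <;> simp)
      (suppIn_weightOn _ _) (fun v => by rw [weightOn_apply]; split_ifs <;> simp) ?_
    · ext v
      have := DFunLike.congr_fun key v
      rw [weightOn_apply, weightOn_apply] at this
      by_cases hv : v ∈ s
      · rw [if_pos hv, if_pos hv] at this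
        simp only [Finsupp.coe_zero, Pi.zero_apply]
        rcases le_total (f v) 0 with h' | h'
        · rw [max_eq_right h', max_eq_left (by linarith)] at this
          linarith
        · rw [max_eq_left h', max_eq_right (by linarith)] at this
          linarith
      · exact hf v hv
    · have : (weightOn s fun v => max (f v) 0) - (weightOn s fun v => max (-f v) 0) = f := by
        ext v
        rw [Finsupp.sub_apply, weightOn_apply, weightOn_apply]
        by_cases hv : v ∈ s
        · rw [if_pos hv, if_pos hv]
          rcases le_total (f v) 0 with h' | h'
          · rw [max_eq_right h', max_eq_left (by linarith)]; ring
          · rw [max_eq_left h', max_eq_right (by linarith)]; ring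
        · simp [hv, hf v hv]
      rw [← sub_eq_zero, ← map_sub, this, h]
  inter_subset_convexHull {s t} hs ht := by
    rintro z ⟨h1, h2⟩
    obtain ⟨f, hf, hf0, hf1⟩ := mem_convexHull_iff_bary.mp h1
    obtain ⟨g, hg, hg0, hg1⟩ := mem_convexHull_iff_bary.mp h2
    have hfg := hU s hs t ht f g hf hf0 hg hg0 (hf1.trans hg1.symm)
    rw [← Finset.coe_inter, mem_convexHull_iff_bary]
    refine ⟨f, fun v hv => ?_, hf0, hf1⟩
    by_cases hvs : v ∈ s
    · rw [hfg]
      exact hg v fun hvt => hv (Finset.mem_inter.mpr ⟨hvs, hvt⟩)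
    · exact hf v hvs

/-- Weights on two faces `s` and `t` that are nonnegative off a common face `A` and represent the
same point agree. -/
lemma weights_unique_of_nonneg_off {A s t : Finset E} (hs : s ∈ K.faces) (ht : t ∈ K.faces)
    (hAs : A ⊆ s) (hAt : A ⊆ t) {f g : E →₀ ℝ} (hf : SuppIn f s)
    (hf0 : ∀ v, v ∉ A → 0 ≤ f v) (hg : SuppIn g t) (hg0 : ∀ v, v ∉ A → 0 ≤ g v)
    (h : bary f = bary g) : f = g := by
  let N : E →₀ ℝ := weightOn A fun v => |f v| + |g v|
  have hN : ∀ v, N v = if v ∈ A then |f v| + |g v| else 0 := fun v => rfl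
  have hNA : SuppIn N A := suppIn_weightOn _ _
  have key := weights_unique hs ht (f := f + N) (g := g + N)
    (fun v hv => by simp [hf v hv, hNA.mono hAs v hv])
    (fun v => by
      rw [Finsupp.add_apply, hN]
      split_ifs with hv
      · have := neg_abs_le (f v); have := abs_nonneg (g v); linarith
      · have := hf0 v hv; linarith)
    (fun v hv => by simp [hg v hv, hNA.mono hAt v hv])
    (fun v => by
      rw [Finsupp.add_apply, hN]
      split_ifs with hv
      · have := neg_abs_le (g v); have := abs_nonneg (f v); linarith
      · have := hg0 v hv; linarith)
    (by rw [map_add, map_add, h])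
  exact add_right_cancel key

end Complexes

section Flips

/-- The faces obtained by replacing the simplices containing `A` by `∂A ⋆ B`. -/
def flipFaces (F : Set (Finset E)) (A B : Finset E) : Set (Finset E) :=
  (F \ {s | A ⊆ s}) ∪ {s | ∃ A' : Finset E, A' ⊂ A ∧ s = A' ∪ B}

/-- The faces of the stellar subdivision of `F` at the simplex `A` with new vertex `p`. -/
def stellarFaces (F : Set (Finset E)) (A : Finset E) (p : E) : Set (Finset E) :=
  (F \ {s | A ⊆ s}) ∪ {s | ∃ A' C : Finset E, A' ⊂ A ∧ Disjoint A C ∧ A ∪ C ∈ F ∧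
    s = insert p (A' ∪ C)}

lemma exists_tight_ratio {B : Finset E} (hB : B.Nonempty) {f c : E → ℝ}
    (hf : ∀ b ∈ B, 0 ≤ f b) (hc : ∀ b ∈ B, 0 < c b) :
    ∃ τ : ℝ, 0 ≤ τ ∧ (∀ b ∈ B, τ * c b ≤ f b) ∧ ∃ b ∈ B, f b = τ * c b := by
  obtain ⟨b, hb, hmin⟩ := B.exists_min_image (fun b => f b / c b) hB
  refine ⟨f b / c b, div_nonneg (hf b hb) (hc b hb).le, fun b' hb' => ?_, b, hb, ?_⟩
  · exact (le_div_iff₀ (hc b' hb')).mp (hmin b' hb')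
  · field_simp [(hc b hb).ne']

variable {K : Geometry.SimplicialComplex ℝ E} {A B : Finset E} {c : E →₀ ℝ}

lemma union_erase_mem (hdisj : Disjoint A B)
    (hlink : ∀ C, Disjoint A C → (A ∪ C ∈ K.faces ↔ C ⊂ B)) {b : E} (hb : b ∈ B) :
    A ∪ B.erase b ∈ K.faces :=
  (hlink _ (hdisj.mono_right (Finset.erase_subset _ _))).mpr (Finset.erase_ssubset hb)

/-- Pushing a nonnegative weight on `A ∪ B` along the circuit onto a face containing `A`. -/
lemma exists_push (hB : B.Nonempty) (hdisj : Disjoint A B)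
    (hlink : ∀ C, Disjoint A C → (A ∪ C ∈ K.faces ↔ C ⊂ B))
    (hc : SuppIn c (A ∪ B)) (hcA : ∀ a ∈ A, 0 < c a) (hcB : ∀ b ∈ B, c b < 0)
    {f : E →₀ ℝ} (hf : SuppIn f (A ∪ B)) (hf0 : WNonneg f) :
    ∃ τ : ℝ, 0 ≤ τ ∧ ∃ b ∈ B, A ∪ B.erase b ∈ K.faces ∧ SuppIn (f + τ • c) (A ∪ B.erase b) ∧
      WNonneg (f + τ • c) := by
  obtain ⟨τ, hτ, hle, b, hb, heq⟩ := exists_tight_ratio (c := fun v => -c v) hB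
    (fun b _ => hf0 b) (fun b hb => by have := hcB b hb; simpa using this)
  refine ⟨τ, hτ, b, hb, union_erase_mem hdisj hlink hb, fun v hv => ?_, fun v => ?_⟩
  · rw [Finsupp.add_apply, Finsupp.smul_apply, smul_eq_mul]
    by_cases hvb : v = b
    · subst hvb; linarith
    · have : v ∉ A ∪ B := by
        simp only [Finset.mem_union, Finset.mem_erase] at hv ⊢; tauto
      rw [hf v this, hc v this]; ring
  · rw [Finsupp.add_apply, Finsupp.smul_apply, smul_eq_mul]
    by_cases hvA : v ∈ A
    · have := mul_nonneg hτ (hcA v hvA).le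
      have := hf0 v
      linarith
    · by_cases hvB : v ∈ B
      · have := hle v hvB; linarith
      · have : v ∉ A ∪ B := by simp [hvA, hvB]
        rw [hf v this, hc v this]; simp

lemma isRelLowerSet_flipFaces (hB : B.Nonempty) (hdisj : Disjoint A B)
    (hlink : ∀ C, Disjoint A C → (A ∪ C ∈ K.faces ↔ C ⊂ B)) :
    IsRelLowerSet (flipFaces K.faces A B) Finset.Nonempty := by
  rintro s (⟨hs, hAs⟩ | ⟨A', hA', rfl⟩)
  · refine ⟨K.nonempty_of_mem_faces hs, fun t hts ht => Or.inl ⟨K.down_closed hs hts ht, ?_⟩⟩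
    exact fun h => hAs (Finset.Subset.trans h hts)
  · refine ⟨hB.mono Finset.subset_union_right, fun t hts ht => ?_⟩
    have hts : t ⊆ A' ∪ B := hts
    have hnot : ¬ A ⊆ t := fun h => hA'.2 fun a ha => by
      rcases Finset.mem_union.mp (hts (h ha)) with h1 | h1
      · exact h1
      · exact absurd h1 (Finset.disjoint_left.mp hdisj ha)
    by_cases hBt : B ⊆ t
    · refine Or.inr ⟨t ∩ A', ?_, ?_⟩
      · exact Finset.ssubset_of_subset_of_ssubset Finset.inter_subset_right hA'
      · ext v
        have := @hts v; have := @hBt v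
        simp only [Finset.mem_union, Finset.mem_inter] at *
        tauto
    · refine Or.inl ⟨K.down_closed (s := A ∪ (B ∩ t)) ?_ ?_ ht, hnot⟩
      · refine (hlink _ (hdisj.mono_right Finset.inter_subset_left)).mpr ⟨Finset.inter_subset_left,
          fun h => hBt fun b hb => (Finset.mem_inter.mp (h hb)).2⟩
      · intro v hv
        have := @hts v hv; have := @hA'.1 v
        simp only [Finset.mem_union, Finset.mem_inter] at *
        tauto

/-- A weight supported on a circuit with a vanishing barycentric image is a multiple of the
dependence of the circuit. -/
lemma eq_smul_of_circuit (hB : B.Nonempty) (hdisj : Disjoint A B)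
    (hlink : ∀ C, Disjoint A C → (A ∪ C ∈ K.faces ↔ C ⊂ B))
    (hc : SuppIn c (A ∪ B)) (hc0 : bary c = 0) (hcB : ∀ b ∈ B, c b < 0)
    {f : E →₀ ℝ} (hf : SuppIn f (A ∪ B)) (hf0 : bary f = 0) : ∃ r : ℝ, f = r • c := by
  obtain ⟨b, hb⟩ := hB
  refine ⟨f b / c b, ?_⟩
  rw [← sub_eq_zero]
  refine eq_zero_of_bary_eq_zero (K.indep (union_erase_mem hdisj hlink hb)) (fun v hv => ?_)
    (by rw [map_sub, map_smul, hf0, hc0]; simp)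
  rw [Finsupp.sub_apply, Finsupp.smul_apply, smul_eq_mul]
  by_cases hvb : v = b
  · subst hvb
    have := (hcB v hb).ne
    field_simp
    ring
  · have : v ∉ A ∪ B := by
      simp only [Finset.mem_union, Finset.mem_erase] at hv ⊢; tauto
    rw [hf v this, hc v this]; ring

/-- Replacing `A ⋆ ∂B` by `∂A ⋆ B` along a circuit gives a geometric bistellar move. -/
theorem exists_bistellarMove {n : ℕ} (hA : A ∈ K.faces) (hB : B.Nonempty)
    (hcard : A.card + B.card = n + 2) (hdisj : Disjoint A B)
    (hlink : ∀ C, Disjoint A C → (A ∪ C ∈ K.faces ↔ C ⊂ B))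
    (hc : SuppIn c (A ∪ B)) (hc0 : bary c = 0) (hcA : ∀ a ∈ A, 0 < c a)
    (hcB : ∀ b ∈ B, c b < 0) :
    ∃ K' : Geometry.SimplicialComplex ℝ E, K'.faces = flipFaces K.faces A B ∧
      K'.space = K.space ∧ BistellarMove n K K' := by
  have hAne := K.nonempty_of_mem_faces hA
  have old_new : ∀ s ∈ K.faces, ¬ A ⊆ s → ∀ A', A' ⊂ A → ∀ f g : E →₀ ℝ, SuppIn f s →
      WNonneg f → SuppIn g (A' ∪ B) → WNonneg g → bary f = bary g → f = g := by
    intro s hs hAs A' hA' f g hf hf0 hg hg0 hfg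
    have hg' : SuppIn g (A ∪ B) := hg.mono (Finset.union_subset_union_left hA'.1)
    obtain ⟨τ, hτ, b, hb, hface, hsupp, hnn⟩ := exists_push hB hdisj hlink hc hcA hcB hg' hg0
    have key := weights_unique hs hface hf hf0 hsupp hnn
      (by rw [map_add, map_smul, hc0, hfg]; simp)
    rcases hτ.eq_or_lt with h0 | hpos
    · rw [key, ← h0]; simp
    · refine absurd (fun a ha => ?_) hAs
      by_contra has
      have h1 := hf a has
      rw [key, Finsupp.add_apply, Finsupp.smul_apply, smul_eq_mul] at h1
      have := mul_pos hpos (hcA a ha)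
      have := hg0 a
      linarith
  have new_new : ∀ A₁, A₁ ⊂ A → ∀ A₂, A₂ ⊂ A → ∀ f g : E →₀ ℝ, SuppIn f (A₁ ∪ B) → WNonneg f →
      SuppIn g (A₂ ∪ B) → WNonneg g → bary f = bary g → f = g := by
    intro A₁ hA₁ A₂ hA₂ f g hf hf0 hg hg0 hfg
    have hf' : SuppIn f (A ∪ B) := hf.mono (Finset.union_subset_union_left hA₁.1)
    have hg' : SuppIn g (A ∪ B) := hg.mono (Finset.union_subset_union_left hA₂.1)
    obtain ⟨r, hr⟩ := eq_smul_of_circuit hB hdisj hlink hc hc0 hcB (f := f - g)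
      (fun v hv => by simp [hf' v hv, hg' v hv]) (by rw [map_sub, hfg, sub_self])
    have hv : ∀ v, f v - g v = r * c v := fun v => by
      have := DFunLike.congr_fun hr v
      simpa using this
    have missing : ∀ A', A' ⊂ A → ∃ a ∈ A, a ∉ A' ∪ B := by
      intro A' hA'
      obtain ⟨a, ha, ha'⟩ := Finset.exists_of_ssubset hA'
      exact ⟨a, ha, by
        rw [Finset.mem_union]
        rintro (h | h)
        · exact ha' h
        · exact Finset.disjoint_left.mp hdisj ha h⟩
    have hr0 : r = 0 := by
      rcases lt_trichotomy r 0 with h | h | h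
      · obtain ⟨a, ha, ha'⟩ := missing A₂ hA₂
        have h1 := hv a
        rw [hg a ha'] at h1
        have := mul_neg_of_neg_of_pos h (hcA a ha)
        have := hf0 a
        linarith
      · exact h
      · obtain ⟨a, ha, ha'⟩ := missing A₁ hA₁
        have h1 := hv a
        rw [hf a ha'] at h1
        have := mul_pos h (hcA a ha)
        have := hg0 a
        linarith
    rw [hr0, zero_smul, sub_eq_zero] at hr
    exact hr
  let K' : Geometry.SimplicialComplex ℝ E := complexOfUnique (flipFaces K.faces A B)
    (isRelLowerSet_flipFaces hB hdisj hlink) (by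
      rintro s (⟨hs, hAs⟩ | ⟨A₁, hA₁, rfl⟩) t (⟨ht, hAt⟩ | ⟨A₂, hA₂, rfl⟩) f g hf hf0 hg hg0 h
      · exact weights_unique hs ht hf hf0 hg hg0 h
      · exact old_new s hs hAs A₂ hA₂ f g hf hf0 hg hg0 h
      · exact (old_new t ht hAt A₁ hA₁ g f hg hg0 hf hf0 h.symm).symm
      · exact new_new A₁ hA₁ A₂ hA₂ f g hf hf0 hg hg0 h)
  have hfaces : K'.faces = flipFaces K.faces A B := rfl
  have hspace : K'.space = K.space := by
    ext z
    rw [mem_space_iff_bary, mem_space_iff_bary, hfaces]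
    constructor
    · rintro ⟨s, ⟨hs, hAs⟩ | ⟨A', hA', rfl⟩, f, hf, hf0, hf1⟩
      · exact ⟨s, hs, f, hf, hf0, hf1⟩
      · obtain ⟨τ, hτ, b, hb, hface, hsupp, hnn⟩ := exists_push hB hdisj hlink hc hcA hcB
          (hf.mono (Finset.union_subset_union_left hA'.1)) hf0
        exact ⟨_, hface, _, hsupp, hnn, by rw [map_add, map_smul, hc0, hf1]; simp⟩
    · rintro ⟨s, hs, f, hf, hf0, hf1⟩
      by_cases hAs : A ⊆ s
      · have hsB : s \ A ⊂ B := by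
          rw [← hlink _ Finset.disjoint_sdiff, Finset.union_sdiff_of_subset hAs]
          exact hs
        obtain ⟨τ, hτ, hle, a, ha, heq⟩ := exists_tight_ratio hAne (fun b _ => hf0 b) hcA
        refine ⟨A.erase a ∪ B, Or.inr ⟨_, Finset.erase_ssubset ha, rfl⟩, f - τ • c, fun v hv => ?_,
          fun v => ?_, by rw [map_sub, map_smul, hc0, hf1]; simp⟩
        · rw [Finsupp.sub_apply, Finsupp.smul_apply, smul_eq_mul]
          by_cases hva : v = a
          · subst hva; linarith
          · have h1 : v ∉ A ∪ B := by
              simp only [Finset.mem_union, Finset.mem_erase] at hv ⊢; tauto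
            have h2 : v ∉ s := fun h => by
              rw [Finset.mem_union, not_or] at h1
              exact h1.2 (hsB.1 (Finset.mem_sdiff.mpr ⟨h, h1.1⟩))
            rw [hf v h2, hc v h1]; ring
        · rw [Finsupp.sub_apply, Finsupp.smul_apply, smul_eq_mul]
          by_cases hvA : v ∈ A
          · have := hle v hvA; linarith
          · have hcv : c v ≤ 0 := by
              by_cases hvB : v ∈ B
              · exact (hcB v hvB).le
              · exact (hc v (by simp [hvA, hvB])).le
            have := mul_nonpos_of_nonneg_of_nonpos hτ hcv
            have := hf0 v
            linarith
      · exact ⟨s, Or.inl ⟨hs, hAs⟩, f, hf, hf0, hf1⟩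
  refine ⟨K', hfaces, hspace, A, B, hA, fun hBK => ?_, hB, hcard, ?_, hfaces, hspace⟩
  · obtain ⟨a, ha⟩ := hAne
    have haB := Finset.disjoint_left.mp hdisj ha
    have key := weights_unique hA hBK (f := weightOn A c) (g := weightOn B fun v => -c v)
      (suppIn_weightOn _ _)
      (fun v => by
        rw [weightOn_apply]
        split_ifs with h
        · exact (hcA v h).le
        · exact le_rfl)
      (suppIn_weightOn _ _)
      (fun v => by
        rw [weightOn_apply]
        split_ifs with h
        · have := hcB v h; linarith
        · exact le_rfl) (by
        rw [← sub_eq_zero, ← map_sub, ← hc0]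
        congr 1
        ext v
        rw [Finsupp.sub_apply, weightOn_apply, weightOn_apply]
        by_cases hvA : v ∈ A
        · simp [hvA, Finset.disjoint_left.mp hdisj hvA]
        · by_cases hvB : v ∈ B
          · simp [hvA, hvB]
          · rw [hc v (by simp [hvA, hvB])]
            simp [hvA, hvB])
    have := DFunLike.congr_fun key a
    rw [weightOn_apply, weightOn_apply, if_pos ha, if_neg haB] at this
    exact (hcA a ha).ne' this
  · ext C
    constructor
    · rintro ⟨hC, hAC, hf⟩
      exact ⟨hC, (hlink C hAC).mp hf⟩
    · rintro ⟨hC, hCB⟩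
      have := hdisj.mono_right hCB.1
      exact ⟨hC, this, (hlink C this).mpr hCB⟩

lemma flipFaces_flipFaces (hBK : B ∉ K.faces) (hB : B.Nonempty)
    (hdisj : Disjoint A B) (hlink : ∀ C, Disjoint A C → (A ∪ C ∈ K.faces ↔ C ⊂ B)) :
    flipFaces (flipFaces K.faces A B) B A = K.faces := by
  ext s
  constructor
  · rintro (⟨⟨hs, -⟩ | ⟨A', hA', rfl⟩, hBs⟩ | ⟨B', hB', rfl⟩)
    · exact hs
    · exact absurd Finset.subset_union_right hBs
    · rw [Finset.union_comm]
      exact (hlink _ (hdisj.mono_right hB'.1)).mpr hB'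
  · intro hs
    by_cases hAs : A ⊆ s
    · refine Or.inr ⟨s \ A, ?_, ?_⟩
      · rw [← hlink _ Finset.disjoint_sdiff, Finset.union_sdiff_of_subset hAs]
        exact hs
      · rw [Finset.sdiff_union_of_subset hAs]
    · exact Or.inl ⟨Or.inl ⟨hs, hAs⟩, fun h => hBK (K.down_closed hs h hB)⟩

/-- Geometric bistellar moves are reversible. -/
theorem BistellarMove.symm {n : ℕ} {K K' : Geometry.SimplicialComplex ℝ E}
    (h : BistellarMove n K K') : BistellarMove n K' K := by
  obtain ⟨A, B, hA, hBK, hB, hcard, hlink, hfaces, hspace⟩ := h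
  have hAne := K.nonempty_of_mem_faces hA
  have hlink' : ∀ C : Finset E, C.Nonempty → (Disjoint A C ∧ A ∪ C ∈ K.faces ↔ C ⊂ B) := by
    intro C hC
    have := Set.ext_iff.mp hlink C
    simpa [hC] using this
  have hdisj : Disjoint A B := by
    rw [Finset.disjoint_left]
    intro v hvA hvB
    by_cases h1 : ({v} : Finset E) ⊂ B
    · have := ((hlink' {v} (Finset.singleton_nonempty v)).mpr h1).1
      simp [hvA] at this
    · have : B = {v} := by
        by_contra hne
        exact h1 ((Finset.singleton_subset_iff.mpr hvB).ssubset_of_ne (Ne.symm hne))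
      apply hBK
      rw [this]
      exact K.down_closed hA (Finset.singleton_subset_iff.mpr hvA) (Finset.singleton_nonempty v)
  have hlink'' : ∀ C, Disjoint A C → (A ∪ C ∈ K.faces ↔ C ⊂ B) := by
    intro C hC
    rcases C.eq_empty_or_nonempty with rfl | hCne
    · simp [hA, hB]
    · rw [← hlink' C hCne]
      tauto
  have hfl : K'.faces = flipFaces K.faces A B := hfaces
  refine ⟨B, A, ?_, ?_, hAne, by omega, ?_, ?_, hspace.symm⟩
  · rw [hfl]
    refine Or.inr ⟨∅, ?_, by simp⟩
    simpa using hAne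
  · rw [hfl]
    rintro (⟨-, h⟩ | ⟨A', hA', h⟩)
    · exact h (Finset.Subset.refl _)
    · obtain ⟨b, hb⟩ := hB
      exact Finset.disjoint_left.mp hdisj (h ▸ Finset.mem_union_right A' hb) hb
  · ext C
    simp only [Set.mem_ofPred_eq, and_congr_right_iff]
    intro hC
    rw [hfl]
    constructor
    · rintro ⟨hBC, ⟨hf, -⟩ | ⟨A', hA', h⟩⟩
      · exact absurd (K.down_closed hf Finset.subset_union_left hB) hBK
      · have hCA : C ⊆ A' := by
          intro v hv
          have : v ∈ A' ∪ B := h ▸ Finset.mem_union_right B hv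
          rcases Finset.mem_union.mp this with h1 | h1
          · exact h1
          · exact absurd hv (Finset.disjoint_left.mp hBC h1)
        exact Finset.ssubset_of_subset_of_ssubset hCA hA'
    · intro hCA
      exact ⟨(hdisj.mono_left hCA.1).symm, Or.inr ⟨C, hCA, Finset.union_comm _ _⟩⟩
  · rw [hfl]
    exact (flipFaces_flipFaces hBK hB hdisj hlink'').symm

end Flips

section StellarCombinatorics

variable {K : Geometry.SimplicialComplex ℝ E}

/-- A flip `(F, G)` with `A ⊆ F` and `p ∈ G` does not change the stellar subdivision at `A` with
new vertex `p`. -/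
lemma stellarFaces_flipFaces {A F G : Finset E} {p : E} (hAF : A ⊆ F)
    (hA : A.Nonempty) (hpG : p ∈ G) (hdisj : Disjoint F G)
    (hlink : ∀ C, Disjoint F C → (F ∪ C ∈ K.faces ↔ C ⊂ G)) :
    stellarFaces (flipFaces K.faces F G) A p = stellarFaces K.faces A p := by
  have hpF : p ∉ F := fun h => Finset.disjoint_left.mp hdisj h hpG
  have hpA : p ∉ A := fun h => hpF (hAF h)
  have hFG : F ∪ G.erase p ∈ K.faces := union_erase_mem hdisj hlink hpG
  have notsub : ∀ A' C : Finset E, A' ⊂ A → Disjoint A C → ¬ A ⊆ insert p (A' ∪ C) := by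
    intro A' C hA' hC h
    refine hA'.2 fun a ha => ?_
    have := h ha
    rw [Finset.mem_insert, Finset.mem_union] at this
    rcases this with rfl | h1 | h1
    · exact absurd ha hpA
    · exact h1
    · exact absurd h1 (Finset.disjoint_left.mp hC ha)
  ext s
  constructor
  · rintro (⟨⟨hs, -⟩ | ⟨F', hF', rfl⟩, hAs⟩ | ⟨A', C, hA', hC, hAC, rfl⟩)
    · exact Or.inl ⟨hs, hAs⟩
    · have hAs : ¬ A ⊆ F' ∪ G := hAs
      refine Or.inr ⟨A ∩ F', (F' \ A) ∪ G.erase p, ⟨Finset.inter_subset_left, fun h => ?_⟩,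
        ?_, ?_, ?_⟩
      · exact hAs fun a ha => Finset.mem_union_left _ (Finset.mem_inter.mp (h ha)).2
      · rw [Finset.disjoint_left]
        intro a ha h
        simp only [Finset.mem_union, Finset.mem_sdiff, Finset.mem_erase] at h
        have := Finset.disjoint_left.mp hdisj (hAF ha)
        tauto
      · refine K.down_closed hFG ?_ (hA.mono Finset.subset_union_left)
        intro v hv
        have := @hAF v; have := @hF'.1 v
        simp only [Finset.mem_union, Finset.mem_sdiff, Finset.mem_erase] at *
        tauto
      · ext v
        by_cases hv : v = p
        · subst hv; simp [hpG]
        · simp only [Finset.mem_union, Finset.mem_sdiff, Finset.mem_erase, Finset.mem_insert,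
            Finset.mem_inter]
          tauto
    · rcases hAC with ⟨hAC, -⟩ | ⟨F', hF', hAC⟩
      · exact Or.inr ⟨A', C, hA', hC, hAC, rfl⟩
      · refine Or.inr ⟨A', C.erase p, hA', hC.mono_right (Finset.erase_subset _ _), ?_, ?_⟩
        · refine K.down_closed hFG ?_ (hA.mono Finset.subset_union_left)
          intro v hv
          have h1 : v ∈ A ∪ C ↔ v ∈ F' ∪ G := by rw [hAC]
          have := @hAF v; have := @hF'.1 v
          simp only [Finset.mem_union, Finset.mem_erase] at *
          by_cases hvp : v = p
          · subst hvp; tauto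
          · tauto
        · ext v
          simp only [Finset.mem_union, Finset.mem_erase, Finset.mem_insert]
          tauto
  · rintro (⟨hs, hAs⟩ | ⟨A', C, hA', hC, hAC, rfl⟩)
    · exact Or.inl ⟨Or.inl ⟨hs, fun h => hAs (hAF.trans h)⟩, hAs⟩
    · by_cases hFAC : F ⊆ A ∪ C
      · set D := (A ∪ C) \ F with hD
        have hFD : F ∪ D = A ∪ C := Finset.union_sdiff_of_subset hFAC
        have hDd : Disjoint F D := Finset.disjoint_sdiff
        have hDG : D ⊂ G := (hlink D hDd).mp (by rw [hFD]; exact hAC)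
        have memD : ∀ v, v ∈ D ↔ (v ∈ A ∨ v ∈ C) ∧ v ∉ F := fun v => by
          rw [hD, Finset.mem_sdiff, Finset.mem_union]
        by_cases hDp : insert p D = G
        · refine Or.inl ⟨Or.inr ⟨A' ∪ (F \ A), ⟨?_, fun h => ?_⟩, ?_⟩, notsub A' C hA' hC⟩
          · exact Finset.union_subset (hA'.1.trans hAF) Finset.sdiff_subset
          · refine hA'.2 fun a ha => ?_
            have := h (hAF ha)
            simp only [Finset.mem_union, Finset.mem_sdiff] at this
            tauto
          · rw [← hDp]
            ext v
            have h1 := memD v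
            have h2 : v ∈ F → v ∈ A ∨ v ∈ C := fun h => Finset.mem_union.mp (hFAC h)
            have h3 := @hA'.1 v
            have h4 := @hAF v
            have h5 : v ∈ A → v ∉ C := fun hv => Finset.disjoint_left.mp hC hv
            simp only [Finset.mem_union, Finset.mem_sdiff, Finset.mem_insert]
            clear * - h1 h2 h3 h4 h5
            tauto
        · have hDG' : insert p D ⊂ G :=
            (Finset.insert_subset hpG hDG.1).ssubset_of_ne hDp
          have hmem : F ∪ insert p D ∈ K.faces :=
            (hlink _ (hdisj.mono_right hDG'.1)).mpr hDG'
          have hs : insert p (A' ∪ C) ∈ K.faces := by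
            refine K.down_closed hmem ?_ (Finset.insert_nonempty _ _)
            intro v hv
            have := memD v; have := @hA'.1 v; have := @hAF v
            simp only [Finset.mem_union, Finset.mem_insert] at *
            tauto
          have := notsub A' C hA' hC
          exact Or.inl ⟨Or.inl ⟨hs, fun h => this (hAF.trans h)⟩, this⟩
      · exact Or.inr ⟨A', C, hA', hC, Or.inl ⟨hAC, hFAC⟩, rfl⟩

lemma stellarFaces_eq_self {F : Set (Finset E)} {A : Finset E} {p : E}
    (h : ∀ s ∈ F, ¬ A ⊆ s) : stellarFaces F A p = F := by
  ext s
  constructor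
  · rintro (⟨hs, -⟩ | ⟨A', C, -, -, hAC, -⟩)
    · exact hs
    · exact absurd Finset.subset_union_left (h _ hAC)
  · exact fun hs => Or.inl ⟨hs, h s hs⟩

lemma finite_stellarFaces {A : Finset E} {p : E} (hK : K.faces.Finite) :
    (stellarFaces K.faces A p).Finite := by
  refine Set.Finite.subset (hK.union ((hK.insert ∅).image fun s => insert p s)) ?_
  rintro s (⟨hs, -⟩ | ⟨A', C, hA', -, hAC, rfl⟩)
  · exact Or.inl hs
  · refine Or.inr ⟨A' ∪ C, ?_, rfl⟩
    rcases (A' ∪ C).eq_empty_or_nonempty with h | h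
    · exact Or.inl h
    · exact Or.inr (K.down_closed hAC (Finset.union_subset_union_left hA'.1) h)

lemma finite_flipFaces {F : Set (Finset E)} {A B : Finset E} (hF : F.Finite) :
    (flipFaces F A B).Finite := by
  refine Set.Finite.subset (hF.union ((A.powerset.finite_toSet).image fun s => s ∪ B)) ?_
  rintro s (⟨hs, -⟩ | ⟨A', hA', rfl⟩)
  · exact Or.inl hs
  · exact Or.inr ⟨A', by simpa using hA'.1, rfl⟩

/-- The faces of a stellar subdivision containing the new vertex. -/
lemma mem_stellarFaces_of_mem {A s : Finset E} {p : E} (hp : ∀ s ∈ K.faces, p ∉ s) (hps : p ∈ s) :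
    s ∈ stellarFaces K.faces A p ↔ ∃ A' C : Finset E, A' ⊂ A ∧ Disjoint A C ∧ A ∪ C ∈ K.faces ∧
      s = insert p (A' ∪ C) := by
  constructor
  · rintro (⟨hs, -⟩ | h)
    · exact absurd hps (hp s hs)
    · exact h
  · exact Or.inr

/-- Stellar subdividing at `A` with new vertex `q` and then at the facet of the cone opposite to
`x` with new vertex `p` gives the same faces as stellar subdividing at `A` with new vertex `p` and
then at the edge `{x, p}` with new vertex `q`. -/
lemma stellarFaces_comm {A : Finset E} {x p q : E} (hx : x ∈ A) (hA : 1 < A.card)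
    (hp : ∀ s ∈ K.faces, p ∉ s) (hq : ∀ s ∈ K.faces, q ∉ s) (hAK : A ∈ K.faces) :
    stellarFaces (stellarFaces K.faces A q) (insert q (A.erase x)) p =
      stellarFaces (stellarFaces K.faces A p) {x, p} q := by
  have hpA := hp A hAK
  have hqA := hq A hAK
  have hxp : x ≠ p := fun h => hpA (h ▸ hx)
  have hxq : x ≠ q := fun h => hqA (h ▸ hx)
  have key : ∀ s, s ∈ stellarFaces (stellarFaces K.faces A q) (insert q (A.erase x)) p ↔
      (s ∈ K.faces ∧ ¬ A ⊆ s) ∨ ∃ A' C : Finset E, A' ⊂ A.erase x ∧ Disjoint A C ∧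
        A ∪ C ∈ K.faces ∧ (s = insert q (A' ∪ C) ∨ s = insert q (insert x (A' ∪ C)) ∨
          s = insert p (A' ∪ C) ∨ s = insert p (insert q (A' ∪ C)) ∨
          s = insert p (A.erase x ∪ C)) := by
    intro s
    have hface : ∀ A' C : Finset E, A' ⊂ A.erase x → Disjoint A C → A ∪ C ∈ K.faces →
        insert q (A.erase x) ∪ C ∈ stellarFaces K.faces A q := fun A' C _ hC hAC =>
      Or.inr ⟨A.erase x, C, Finset.erase_ssubset hx, hC, hAC, by grind⟩
    constructor
    · rintro (⟨⟨hs, hAs⟩ | ⟨A', C, hA', hC, hAC, rfl⟩, hs'⟩ | ⟨A'', C₀, hA'', hC₀, hf, rfl⟩)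
      · exact Or.inl ⟨hs, hAs⟩
      · have hs' : ¬ insert q (A.erase x) ⊆ insert q (A' ∪ C) := hs'
        refine Or.inr ⟨A'.erase x, C, ⟨by grind, fun h => hs' ?_⟩, hC, hAC, ?_⟩
        · grind
        · by_cases hxA' : x ∈ A'
          · right; left; grind
          · left; grind
      · rw [mem_stellarFaces_of_mem hq (by simp)] at hf
        obtain ⟨A', D, hA', hD, hAD, h⟩ := hf
        have hqD : q ∉ D := fun h => hq _ hAD (Finset.mem_union_right _ h)
        have hD' : ∀ v, v ∈ A → v ∉ D := fun v hv => Finset.disjoint_left.mp hD hv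
        have hC' : ∀ v, v ∈ insert q (A.erase x) → v ∉ C₀ := fun v hv =>
          Finset.disjoint_left.mp hC₀ hv
        have h' := fun v => Finset.ext_iff.mp h v
        have hsub : A.erase x ⊆ A' := by
          intro v hv
          have := h' v
          have := hD' v
          grind
        have hxA' : x ∉ A' := fun hxA' => hA'.2 (by grind)
        have hCD : C₀ = D := by
          ext v
          have := h' v
          have := hD' v
          have := hC' v
          have := @hA'.1 v
          grind
        subst hCD
        by_cases hqA'' : q ∈ A''
        · refine Or.inr ⟨A''.erase q, C₀, ⟨?_, fun h => hA''.2 ?_⟩, hD, hAD, ?_⟩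
          · have := hA''.1; grind
          · grind
          · right; right; right; left; grind
        · by_cases hA''e : A'' = A.erase x
          · refine Or.inr ⟨∅, C₀, ?_, hD, hAD, ?_⟩
            · rw [Finset.empty_ssubset, ← Finset.card_pos, Finset.card_erase_of_mem hx]; omega
            · rw [hA''e]; tauto
          · refine Or.inr ⟨A'', C₀, Finset.ssubset_iff_subset_ne.mpr ⟨?_, hA''e⟩, hD, hAD, ?_⟩
            · have := hA''.1; grind
            · tauto
    · rintro (⟨hs, hAs⟩ | ⟨A', C, hA', hC, hAC, h⟩)
      · exact Or.inl ⟨Or.inl ⟨hs, hAs⟩, fun h => hq s hs (h (by simp))⟩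
      · have hqC : q ∉ C := fun h => hq _ hAC (Finset.mem_union_right _ h)
        have hA'1 := hA'.1
        obtain ⟨y, hy, hyA'⟩ := Finset.exists_of_ssubset hA'
        have hCd := Finset.disjoint_left.mp hC
        have hdj : Disjoint (insert q (A.erase x)) C := by
          rw [Finset.disjoint_left]; grind
        rcases h with rfl | rfl | rfl | rfl | rfl
        · refine Or.inl ⟨Or.inr ⟨A', C, ⟨by grind, fun h => ?_⟩, hC, hAC, rfl⟩, fun h => ?_⟩
          · have := @h y; grind
          · have := @h y; grind
        · refine Or.inl ⟨Or.inr ⟨insert x A', C, ⟨by grind, fun h => ?_⟩, hC, hAC, by grind⟩,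
            fun h => ?_⟩
          · have := @h y; grind
          · have := @h y; grind
        · exact Or.inr ⟨A', C, ⟨by grind, fun h => by have := @h y; grind⟩, hdj,
            hface A' C hA' hC hAC, rfl⟩
        · exact Or.inr ⟨insert q A', C, ⟨by grind, fun h => by have := @h y; grind⟩, hdj,
            hface A' C hA' hC hAC, by grind⟩
        · exact Or.inr ⟨A.erase x, C, ⟨by grind, fun h => by have := @h q; grind⟩, hdj,
            hface A' C hA' hC hAC, rfl⟩
  have key' : ∀ s, s ∈ stellarFaces (stellarFaces K.faces A p) {x, p} q ↔
      (s ∈ K.faces ∧ ¬ A ⊆ s) ∨ ∃ A' C : Finset E, A' ⊂ A.erase x ∧ Disjoint A C ∧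
        A ∪ C ∈ K.faces ∧ (s = insert q (A' ∪ C) ∨ s = insert q (insert x (A' ∪ C)) ∨
          s = insert p (A' ∪ C) ∨ s = insert p (insert q (A' ∪ C)) ∨
          s = insert p (A.erase x ∪ C)) := by
    clear key
    intro s
    constructor
    · rintro (⟨⟨hs, hAs⟩ | ⟨A', C, hA', hC, hAC, rfl⟩, hs'⟩ | ⟨A'', C₀, hA'', hC₀, hf, rfl⟩)
      · exact Or.inl ⟨hs, hAs⟩
      · have hs' : ¬ {x, p} ⊆ insert p (A' ∪ C) := hs'
        have hxA' : x ∉ A' := by grind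
        have hA'1 := hA'.1
        by_cases hA'e : A' = A.erase x
        · refine Or.inr ⟨∅, C, ?_, hC, hAC, ?_⟩
          · rw [Finset.empty_ssubset, ← Finset.card_pos, Finset.card_erase_of_mem hx]; omega
          · rw [hA'e]; tauto
        · exact Or.inr ⟨A', C, Finset.ssubset_iff_subset_ne.mpr ⟨by grind, hA'e⟩, hC, hAC,
            by tauto⟩
      · rw [mem_stellarFaces_of_mem hp (by simp)] at hf
        obtain ⟨A', D, hA', hD, hAD, h⟩ := hf
        have hpD : p ∉ D := fun h => hp _ hAD (Finset.mem_union_right _ h)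
        have hD' : ∀ v, v ∈ A → v ∉ D := fun v hv => Finset.disjoint_left.mp hD hv
        have hC' : ∀ v, v ∈ ({x, p} : Finset E) → v ∉ C₀ := fun v hv =>
          Finset.disjoint_left.mp hC₀ hv
        have h' := fun v => Finset.ext_iff.mp h v
        have hA'1 := hA'.1
        have hxA' : x ∈ A' := by
          have := h' x
          have := hD' x
          grind
        have hC₀e : C₀ = A'.erase x ∪ D := by
          ext v
          have := h' v
          have := hD' v
          have := hC' v
          grind
        refine Or.inr ⟨A'.erase x, D, ⟨by grind, fun h => hA'.2 fun v hv => ?_⟩, hD, hAD, ?_⟩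
        · have := @h v
          grind
        · have hA''1 := hA''.1
          have hA''2 := hA''.2
          have hcases : A'' = ∅ ∨ A'' = {x} ∨ A'' = {p} := by
            by_cases h1 : x ∈ A''
            · by_cases h2 : p ∈ A''
              · exact absurd (by grind) hA''2
              · right; left; grind
            · by_cases h2 : p ∈ A''
              · right; right; grind
              · left; grind
          rcases hcases with rfl | rfl | rfl
          · left; grind
          · right; left; grind
          · right; right; right; left; grind
    · rintro (⟨hs, hAs⟩ | ⟨A', C, hA', hC, hAC, h⟩)
      · exact Or.inl ⟨Or.inl ⟨hs, hAs⟩, fun h => hp s hs (h (by simp))⟩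
      · have hpC : p ∉ C := fun h => hp _ hAC (Finset.mem_union_right _ h)
        have hA'1 := hA'.1
        obtain ⟨y, hy, hyA'⟩ := Finset.exists_of_ssubset hA'
        have hCd := Finset.disjoint_left.mp hC
        have hdj : Disjoint {x, p} (A' ∪ C) := by
          rw [Finset.disjoint_left]; grind
        have hface : {x, p} ∪ (A' ∪ C) ∈ stellarFaces K.faces A p :=
          Or.inr ⟨insert x A', C, ⟨by grind, fun h => by have := @h y; grind⟩, hC, hAC, by grind⟩
        have hAx : A.erase x ⊂ A := Finset.erase_ssubset hx
        rcases h with rfl | rfl | rfl | rfl | rfl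
        · exact Or.inr ⟨∅, A' ∪ C, ⟨by grind, fun h => by have := @h x; grind⟩, hdj, hface,
            by grind⟩
        · exact Or.inr ⟨{x}, A' ∪ C, ⟨by grind, fun h => by have := @h p; grind⟩, hdj, hface,
            by grind⟩
        · exact Or.inl ⟨Or.inr ⟨A', C, hA'.trans hAx, hC, hAC, rfl⟩,
            fun h => by have := @h x; grind⟩
        · exact Or.inr ⟨{p}, A' ∪ C, ⟨by grind, fun h => by have := @h x; grind⟩, hdj, hface,
            by grind⟩
        · exact Or.inl ⟨Or.inr ⟨A.erase x, C, hAx, hC, hAC, rfl⟩,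
            fun h => by have := @h x; grind⟩
  ext s
  rw [key, key']

end StellarCombinatorics

section InteriorFaces

variable {K : Geometry.SimplicialComplex ℝ E}

/-- Some point in the relative interior of `A` lies in the interior of the support of `K`. -/
def IsInteriorFace (K : Geometry.SimplicialComplex ℝ E) (A : Finset E) : Prop :=
  ∃ (q : E →₀ ℝ) (z : E), SuppIn q A ∧ (∀ v ∈ A, 0 < q v) ∧ bary q = (z, 1) ∧ z ∈ interior K.space

lemma wnonneg_of_pos {q : E →₀ ℝ} {A : Finset E} (hq : SuppIn q A) (hpos : ∀ v ∈ A, 0 < q v) :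
    WNonneg q := fun v => by
  by_cases hv : v ∈ A
  · exact (hpos v hv).le
  · exact (hq v hv).ge

/-- Near a relative interior point of `A` that is interior to the support, the complex is the
star of `A`. -/
lemma eventually_mem_star (hK : K.faces.Finite) {A : Finset E} (hA : A ∈ K.faces) {q : E →₀ ℝ}
    {z : E} (hq : SuppIn q A) (hpos : ∀ v ∈ A, 0 < q v) (hb : bary q = (z, 1))
    (hz : z ∈ interior K.space) :
    ∀ᶠ y in nhds z, ∃ s ∈ K.faces, A ⊆ s ∧ y ∈ convexHull ℝ (s : Set E) := by
  have hcl : IsClosed (⋃ s ∈ {s ∈ K.faces | ¬ A ⊆ s}, convexHull ℝ (s : Set E)) :=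
    (hK.subset fun s hs => hs.1).isClosed_biUnion fun s _ =>
      (s.finite_toSet.isCompact_convexHull ℝ).isClosed
  have hzU : z ∉ ⋃ s ∈ {s ∈ K.faces | ¬ A ⊆ s}, convexHull ℝ (s : Set E) := by
    simp only [Set.mem_iUnion, not_exists]
    rintro s ⟨hs, hAs⟩ hzs
    obtain ⟨w, hw, hw0, hw1⟩ := mem_convexHull_iff_bary.mp hzs
    have := weights_unique hA hs hq (wnonneg_of_pos hq hpos) hw hw0 (hb.trans hw1.symm)
    refine hAs fun v hv => ?_
    by_contra hvs
    have h1 := hpos v hv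
    rw [this, hw v hvs] at h1
    exact lt_irrefl _ h1
  filter_upwards [hcl.isOpen_compl.mem_nhds hzU, isOpen_interior.mem_nhds hz] with y hy hy'
  obtain ⟨s, hs, hys⟩ := Geometry.SimplicialComplex.mem_space_iff.mp (interior_subset hy')
  refine ⟨s, hs, ?_, hys⟩
  by_contra hAs
  exact hy (Set.mem_biUnion (show s ∈ {s ∈ K.faces | ¬ A ⊆ s} from ⟨hs, hAs⟩) hys)

/-- The star of an interior face `A` spans all directions: every pair `y` is represented by a
weight on a face containing `A` that is nonnegative off `A`. -/
lemma IsInteriorFace.exists_weight (hK : K.faces.Finite) {A : Finset E} (hA : A ∈ K.faces)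
    (hint : IsInteriorFace K A) (y : E × ℝ) :
    ∃ s ∈ K.faces, A ⊆ s ∧ ∃ f, SuppIn f s ∧ (∀ v, v ∉ A → 0 ≤ f v) ∧ bary f = y := by
  obtain ⟨q, z, hq, hpos, hb, hz⟩ := hint
  have hev := eventually_mem_star hK hA hq hpos hb hz
  have hlim : Filter.Tendsto (fun ε : ℝ => z + ε • (y.1 - y.2 • z)) (nhdsWithin 0 (Set.Ioi 0))
      (nhds z) := by
    have : Filter.Tendsto (fun ε : ℝ => z + ε • (y.1 - y.2 • z)) (nhds 0)
        (nhds (z + (0 : ℝ) • (y.1 - y.2 • z))) := by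
      apply Continuous.tendsto
      fun_prop
    rw [zero_smul, add_zero] at this
    exact this.mono_left nhdsWithin_le_nhds
  obtain ⟨ε, ⟨s, hs, hAs, hzs⟩, hε⟩ := ((hlim.eventually hev).and self_mem_nhdsWithin).exists
  have hε : (0 : ℝ) < ε := hε
  obtain ⟨w, hw, hw0, hw1⟩ := mem_convexHull_iff_bary.mp hzs
  refine ⟨s, hs, hAs, ε⁻¹ • (w - q) + y.2 • q, fun v hv => ?_, fun v hv => ?_, ?_⟩
  · simp [hw v hv, hq v (fun h => hv (hAs h))]
  · simp only [Finsupp.add_apply, Finsupp.smul_apply, Finsupp.sub_apply, smul_eq_mul, hq v hv]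
    have := mul_nonneg (inv_nonneg.mpr hε.le) (hw0 v)
    simpa using this
  · rw [map_add, map_smul, map_smul, map_sub, hw1, hb]
    ext
    · simp [smul_smul, hε.ne']
    · simp

lemma IsInteriorFace.mono {A F : Finset E} (hint : IsInteriorFace K A) (hAF : A ⊆ F) :
    IsInteriorFace K F := by
  obtain ⟨q, z, hq, hpos, hb, hz⟩ := hint
  set u : E →₀ ℝ := weightOn F fun _ => 1 with hu
  have huF : SuppIn u F := suppIn_weightOn _ _
  have hu1 : ∀ v ∈ F, u v = 1 := fun v hv => by rw [hu, weightOn_apply, if_pos hv]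
  have hu2 : (bary u).2 = F.card := by
    rw [bary_snd huF, Finset.sum_congr rfl hu1]; simp
  set m : ℝ := (F.card : ℝ) with hm
  have hm0 : 0 ≤ m := Nat.cast_nonneg _
  have hlim : Filter.Tendsto (fun ε : ℝ => (1 + ε * m)⁻¹ • (z + ε • (bary u).1))
      (nhdsWithin 0 (Set.Ioi 0)) (nhds z) := by
    have : Filter.Tendsto (fun ε : ℝ => (1 + ε * m)⁻¹ • (z + ε • (bary u).1)) (nhds 0)
        (nhds ((1 + 0 * m)⁻¹ • (z + (0 : ℝ) • (bary u).1))) := by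
      apply ContinuousAt.tendsto
      apply ContinuousAt.smul
      · apply ContinuousAt.inv₀
        · fun_prop
        · simp
      · fun_prop
    simp only [zero_mul, add_zero, inv_one, one_smul, zero_smul] at this
    exact this.mono_left nhdsWithin_le_nhds
  obtain ⟨ε, hε', hε⟩ :=
    ((hlim.eventually (isOpen_interior.mem_nhds hz)).and self_mem_nhdsWithin).exists
  have hε : (0 : ℝ) < ε := hε
  have h1 : 0 < 1 + ε * m := by positivity
  refine ⟨(1 + ε * m)⁻¹ • (q + ε • u), _, fun v hv => ?_, fun v hv => ?_, ?_, hε'⟩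
  · simp [hq v (fun h => hv (hAF h)), huF v hv]
  · have : 0 ≤ q v := wnonneg_of_pos hq hpos v
    simp only [Finsupp.add_apply, Finsupp.smul_apply, smul_eq_mul, hu1 v hv]
    positivity
  · rw [map_smul, map_add, map_smul, hb]
    ext
    · simp
    · simp only [Prod.smul_snd, Prod.snd_add, hu2, smul_eq_mul]
      field_simp

lemma IsInteriorFace.congr_space {K' : Geometry.SimplicialComplex ℝ E} {A : Finset E}
    (h : IsInteriorFace K A) (hsp : K'.space = K.space) : IsInteriorFace K' A := by
  rwa [IsInteriorFace, hsp]

variable [FiniteDimensional ℝ E] {n : ℕ}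

/-- Interior faces of dimension smaller than `n` are proper faces. -/
lemma IsInteriorFace.exists_insert_mem (hn : Module.finrank ℝ E = n) (hK : K.faces.Finite)
    {F : Finset E} (hF : F ∈ K.faces) (hint : IsInteriorFace K F) (hcard : F.card ≤ n) :
    ∃ v, v ∉ F ∧ insert v F ∈ K.faces := by
  by_contra hno
  push Not at hno
  have htop : Submodule.span ℝ ((F.image fun v : E => (v, (1 : ℝ)) : Finset (E × ℝ)) : Set (E × ℝ))
      = ⊤ := by
    rw [eq_top_iff]
    rintro y -
    obtain ⟨s, hs, hFs, f, hf, -, rfl⟩ := hint.exists_weight hK hF y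
    have hsF : s ⊆ F := by
      intro v hv
      by_contra hvF
      exact hno v hvF (K.down_closed hs (Finset.insert_subset hv hFs) (Finset.insert_nonempty _ _))
    have : bary f = ∑ v ∈ F, f v • ((v, 1) : E × ℝ) := by
      rw [bary_eq_sum (hf.mono hsF)]
      ext
      · simp [Prod.fst_sum]
      · simp [Prod.snd_sum]
    rw [this]
    refine Submodule.sum_mem _ fun v hv => Submodule.smul_mem _ _ (Submodule.subset_span ?_)
    exact Finset.mem_coe.mpr (Finset.mem_image_of_mem _ hv)
  have h1 := finrank_span_finset_le_card (R := ℝ) (F.image fun v : E => (v, (1 : ℝ)))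
  rw [Set.finrank, htop, finrank_top, Module.finrank_prod, hn, Module.finrank_self] at h1
  have := Finset.card_image_le (s := F) (f := fun v : E => (v, (1 : ℝ)))
  omega

/-- A codimension-one interior face lies in exactly two top-dimensional faces. -/
lemma IsInteriorFace.exists_circuit (hn : Module.finrank ℝ E = n) (hK : K.faces.Finite)
    {F : Finset E} (hF : F ∈ K.faces) (hint : IsInteriorFace K F) (hcard : F.card = n) {v : E}
    (hv : v ∉ F) (hvF : insert v F ∈ K.faces) :
    ∃ (w : E) (c : E →₀ ℝ), w ∉ F ∧ w ≠ v ∧ insert w F ∈ K.faces ∧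
      SuppIn c (insert v (insert w F)) ∧ c v = 1 ∧ 0 < c w ∧ bary c = 0 ∧
      ∀ u, u ∉ F → insert u F ∈ K.faces → u = v ∨ u = w := by
  obtain ⟨s, hs, hFs, f, hf, hf0, hfb⟩ :=
    hint.exists_weight hK hF (-bary (Finsupp.single v (1 : ℝ)))
  have hc0 : bary (f + Finsupp.single v 1) = 0 := by rw [map_add, hfb, neg_add_cancel]
  have hnot : ¬ SuppIn f (insert v F) := by
    intro h
    have h1 := eq_zero_of_bary_eq_zero (K.indep hvF) (f := f + Finsupp.single v 1) (fun u hu => by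
      have huv : u ≠ v := fun e => hu (e ▸ Finset.mem_insert_self _ _)
      rw [Finsupp.add_apply, h u hu, Finsupp.single_eq_of_ne huv, add_zero]) hc0
    have h2 := DFunLike.congr_fun h1 v
    rw [Finsupp.add_apply, Finsupp.single_eq_same] at h2
    have := hf0 v hv
    simp only [Finsupp.coe_zero, Pi.zero_apply] at h2
    linarith
  have hex : ∃ w, w ∉ insert v F ∧ f w ≠ 0 := by
    rw [SuppIn] at hnot; push Not at hnot; exact hnot
  obtain ⟨w, hw, hfw⟩ := hex
  have hws : w ∈ s := by by_contra h; exact hfw (hf w h)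
  rw [Finset.mem_insert, not_or] at hw
  have hsw : insert w F = s := by
    refine Finset.eq_of_subset_of_card_le (Finset.insert_subset hws hFs) ?_
    rw [Finset.card_insert_of_notMem hw.2, hcard, ← hn]
    exact card_le_of_affineIndependent (K.indep hs)
  subst hsw
  have hvw : v ∉ insert w F := by simp [Ne.symm hw.1, hv]
  have hcv : (f + Finsupp.single v 1 : E →₀ ℝ) v = 1 := by simp [hf v hvw]
  have hcw : 0 < (f + Finsupp.single v 1 : E →₀ ℝ) w := by
    rw [Finsupp.add_apply, Finsupp.single_eq_of_ne hw.1, add_zero]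
    exact lt_of_le_of_ne (hf0 w hw.2) (Ne.symm hfw)
  have hcs : SuppIn (f + Finsupp.single v 1) (insert v (insert w F)) := fun u hu => by
    rw [Finset.mem_insert, not_or] at hu
    rw [Finsupp.add_apply, hf u hu.2, Finsupp.single_eq_of_ne hu.1, add_zero]
  refine ⟨w, _, hw.2, hw.1, hs, hcs, hcv, hcw, hc0, fun u hu huF => ?_⟩
  generalize hc : f + Finsupp.single v 1 = c at *
  obtain ⟨B, hB⟩ := exists_weight_of_card (K.indep hvF)
    (by rw [Finset.card_insert_of_notMem hv, hcard, hn])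
  obtain ⟨hg, hgb⟩ := hB (bary (Finsupp.single u 1))
  set g := B (bary (Finsupp.single u 1)) with hgdef
  have hsu : SuppIn (Finsupp.single u (1 : ℝ)) (insert u F) := fun x hx =>
    Finsupp.single_eq_of_ne (fun e => hx (e ▸ Finset.mem_insert_self _ _))
  have hsu0 : ∀ x, x ∉ F → 0 ≤ Finsupp.single u (1 : ℝ) x := fun x _ => by
    rw [Finsupp.single_apply]; split_ifs <;> norm_num
  by_cases hgv : 0 ≤ g v
  · left
    have := weights_unique_of_nonneg_off huF hvF (Finset.subset_insert _ _)
      (Finset.subset_insert _ _) hsu hsu0 hg (fun x hx => by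
        by_cases hxv : x = v
        · rw [hxv]; exact hgv
        · rw [hg x (by simp [hxv, hx])]) hgb.symm
    by_contra huv
    have h1 := DFunLike.congr_fun this u
    rw [Finsupp.single_eq_same, hg u (by simp [huv, hu])] at h1
    exact one_ne_zero h1
  · right
    push Not at hgv
    have hgc : SuppIn (g - g v • c) (insert w F) := fun x hx => by
      by_cases hxv : x = v
      · subst hxv; simp [hcv]
      · have h1 : x ∉ insert v F := fun h => by
          rw [Finset.mem_insert] at h hx; tauto
        have h2 : x ∉ insert v (insert w F) := fun h => by
          rw [Finset.mem_insert] at h; tauto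
        simp [hg x h1, hcs x h2]
    have hgw : g w = 0 := hg w (by simp [hw.1, hw.2])
    have := weights_unique_of_nonneg_off huF hs (Finset.subset_insert _ _)
      (Finset.subset_insert _ _) hsu hsu0 hgc (fun x hx => by
        by_cases hxw : x = w
        · rw [hxw, Finsupp.sub_apply, Finsupp.smul_apply, smul_eq_mul, hgw]
          nlinarith
        · rw [hgc x (by simp [hxw, hx])]) (by rw [map_sub, map_smul, hc0, smul_zero, sub_zero, hgb])
    by_contra huw
    have h1 := DFunLike.congr_fun this u
    rw [Finsupp.single_eq_same, hgc u (by simp [huw, hu])] at h1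
    exact one_ne_zero h1

end InteriorFaces

section GenericStellar

variable {K : Geometry.SimplicialComplex ℝ E} {n : ℕ}

/-- The point `p` is generic with respect to the top-dimensional faces containing `A`: its
barycentric coordinates do not vanish, and they are positive on `A`. -/
def IsGenericFor (n : ℕ) (K : Geometry.SimplicialComplex ℝ E) (A : Finset E) (p : E) : Prop :=
  ∀ T ∈ K.faces, A ⊆ T → T.card = n + 1 → p ∉ T → ∀ w, SuppIn w T → bary w = (p, 1) →
    (∀ v ∈ T, w v ≠ 0) ∧ ∀ v ∈ A, 0 < w v

lemma reflTransGen_space {K' : Geometry.SimplicialComplex ℝ E}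
    (h : Relation.ReflTransGen (BistellarMove n) K K') : K'.space = K.space := by
  induction h with
  | refl => rfl
  | tail _ h ih =>
    obtain ⟨-, -, -, -, -, -, -, -, h⟩ := h
    exact h.trans ih

/-- A flip at `A` itself with `p` among the new vertices is the stellar subdivision. -/
lemma flipFaces_eq_stellarFaces {A G : Finset E} {p : E} (hA : A ∈ K.faces) (hpG : p ∈ G)
    (hdisj : Disjoint A G) (hlink : ∀ C, Disjoint A C → (A ∪ C ∈ K.faces ↔ C ⊂ G)) :
    flipFaces K.faces A G = stellarFaces K.faces A p := by
  have hAne := K.nonempty_of_mem_faces hA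
  rw [← stellarFaces_flipFaces (Finset.Subset.refl A) hAne hpG hdisj hlink]
  refine (stellarFaces_eq_self ?_).symm
  rintro s (⟨-, hs⟩ | ⟨A', hA', rfl⟩)
  · exact hs
  · intro h
    refine hA'.2 fun v hv => ?_
    rcases Finset.mem_union.mp (h hv) with h1 | h1
    · exact h1
    · exact absurd h1 (Finset.disjoint_left.mp hdisj hv)

lemma suppIn_single (p : E) (r : ℝ) {s : Finset E} (h : p ∈ s) : SuppIn (Finsupp.single p r) s :=
  fun _ hx => Finsupp.single_eq_of_ne (fun e => hx (e ▸ h))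

variable [FiniteDimensional ℝ E]

/-- The link of a codimension-one face contained in exactly two top-dimensional faces. -/
lemma link_eq_pair (hn : Module.finrank ℝ E = n) {A : Finset E} {p w : E} (hA : A ∈ K.faces)
    (hcard : A.card = n) (hpw : p ≠ w) (hpAK : insert p A ∈ K.faces)
    (hwAK : insert w A ∈ K.faces) (huniq : ∀ u, u ∉ A → insert u A ∈ K.faces → u = p ∨ u = w)
    (C : Finset E) (hC : Disjoint A C) : A ∪ C ∈ K.faces ↔ C ⊂ {p, w} := by
  constructor
  · intro hAC
    have h1 := card_le_of_affineIndependent (K.indep hAC)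
    rw [Finset.card_union_of_disjoint hC, hn] at h1
    refine Finset.ssubset_iff_subset_ne.mpr ⟨fun u hu => ?_, fun h => ?_⟩
    · have huA : u ∉ A := Finset.disjoint_right.mp hC hu
      have := huniq u huA (K.down_closed hAC (Finset.insert_subset
        (Finset.mem_union_right _ hu) Finset.subset_union_left) (Finset.insert_nonempty _ _))
      simpa using this
    · rw [h, Finset.card_pair hpw] at h1
      omega
  · intro hC'
    have h2 : C.card < 2 := by
      have := Finset.card_lt_card hC'
      rwa [Finset.card_pair hpw] at this
    rcases C.eq_empty_or_nonempty with rfl | hne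
    · simpa using hA
    · obtain ⟨u, rfl⟩ := Finset.card_eq_one.mp
        (le_antisymm (Nat.le_of_lt_succ h2) hne.card_pos)
      have := hC'.1 (Finset.mem_singleton_self u)
      rw [Finset.union_comm, ← Finset.insert_eq]
      rcases Finset.mem_insert.mp this with rfl | h
      · exact hpAK
      · rw [Finset.mem_singleton.mp h]; exact hwAK

lemma exists_stellar_codim_one (hn : Module.finrank ℝ E = n) (hK : K.faces.Finite)
    {A : Finset E} {p : E} (hA : A ∈ K.faces) (hpA : p ∉ A) (hpAK : insert p A ∈ K.faces)
    (hint : IsInteriorFace K A) (hgen : IsGenericFor n K A p) (hcard : A.card = n) :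
    ∃ K' : Geometry.SimplicialComplex ℝ E, BistellarMove n K K' ∧
      K'.faces = stellarFaces K.faces A p := by
  obtain ⟨w, c, hwA, hwp, hwAK, hcs, hcp, hcw, hc0, huniq⟩ :=
    hint.exists_circuit hn hK hA hcard hpA hpAK
  have hpT : p ∉ insert w A := by simp [hwp.symm, hpA]
  have hg := (hgen _ hwAK (Finset.subset_insert _ _)
    (by rw [Finset.card_insert_of_notMem hwA, hcard]) hpT (Finsupp.single p 1 - c)
    (fun v hv => by
      by_cases hvp : v = p
      · subst hvp; simp [hcp]
      · rw [Finsupp.sub_apply, Finsupp.single_eq_of_ne hvp, hcs v (by simp [hvp]; simpa using hv),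
          sub_zero])
    (by rw [map_sub, hc0, bary_single, one_smul, sub_zero])).2
  have hcA : ∀ v ∈ A, c v < 0 := fun v hv => by
    have := hg v hv
    have hvp : v ≠ p := fun e => hpA (e ▸ hv)
    rw [Finsupp.sub_apply, Finsupp.single_eq_of_ne hvp] at this
    linarith
  have hdisj : Disjoint A {p, w} := by
    rw [Finset.disjoint_right]
    intro v hv
    rcases Finset.mem_insert.mp hv with rfl | hv
    · exact hpA
    · rw [Finset.mem_singleton.mp hv]; exact hwA
  have hlink := link_eq_pair hn hA hcard hwp.symm hpAK hwAK huniq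
  obtain ⟨K', hf, -, hm⟩ := exists_bistellarMove (n := n) (c := -c) hA (B := {p, w}) (by simp)
    (by rw [Finset.card_pair hwp.symm, hcard]) hdisj hlink
    (fun v hv => by
      simp only [Finsupp.neg_apply, neg_eq_zero]
      refine hcs v ?_
      simp only [Finset.mem_union, Finset.mem_insert, Finset.mem_singleton] at hv ⊢
      tauto) (by rw [map_neg, hc0, neg_zero])
    (fun v hv => by have := hcA v hv; simpa using this)
    (fun v hv => by
      rcases Finset.mem_insert.mp hv with rfl | hv
      · simp [hcp]
      · rw [Finset.mem_singleton.mp hv]; simpa using hcw)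
  exact ⟨K', hm, hf.trans (flipFaces_eq_stellarFaces hA (by simp) hdisj hlink)⟩

/-- For a codimension-two face whose link is the boundary of a triangle, the stellar subdivision
is a single flip. -/
lemma exists_stellar_of_triangle (hn : Module.finrank ℝ E = n)
    {A : Finset E} {p v w : E} (hA : A ∈ K.faces) (hcard : A.card + 1 = n)
    (hp : p ∉ A) (hv : v ∉ A) (hw : w ∉ A) (hpv : p ≠ v) (hpw : p ≠ w) (hvw : v ≠ w)
    (h1 : A ∪ {p, v} ∈ K.faces) (h2 : A ∪ {p, w} ∈ K.faces) (h3 : A ∪ {v, w} ∈ K.faces)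
    {c : E →₀ ℝ} (hcs : SuppIn c (A ∪ {p, v, w})) (hc0 : bary c = 0) (hcA : ∀ u ∈ A, c u < 0)
    (hcB : ∀ u ∈ ({p, v, w} : Finset E), 0 < c u) :
    ∃ K' : Geometry.SimplicialComplex ℝ E, BistellarMove n K K' ∧
      K'.faces = stellarFaces K.faces A p := by
  have hAne := K.nonempty_of_mem_faces hA
  have hBcard : ({p, v, w} : Finset E).card = 3 := Finset.card_eq_three.mpr
    ⟨p, v, w, hpv, hpw, hvw, rfl⟩
  have hdisj : Disjoint A {p, v, w} := by
    rw [Finset.disjoint_right]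
    intro u hu
    simp only [Finset.mem_insert, Finset.mem_singleton] at hu
    rcases hu with rfl | rfl | rfl <;> assumption
  have herase : ∀ b ∈ ({p, v, w} : Finset E), A ∪ ({p, v, w} : Finset E).erase b ∈ K.faces := by
    intro b hb
    simp only [Finset.mem_insert, Finset.mem_singleton] at hb
    rcases hb with rfl | rfl | rfl
    · convert h3 using 2; grind
    · convert h2 using 2; grind
    · convert h1 using 2; grind
  have hlink : ∀ C, Disjoint A C → (A ∪ C ∈ K.faces ↔ C ⊂ {p, v, w}) := by
    intro C hC
    constructor
    · intro hAC
      have hle := card_le_of_affineIndependent (K.indep hAC)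
      rw [Finset.card_union_of_disjoint hC, hn] at hle
      refine Finset.ssubset_iff_subset_ne.mpr ⟨fun u hu => ?_, fun h => ?_⟩
      · have huA : u ∉ A := Finset.disjoint_right.mp hC hu
        have huK : insert u A ∈ K.faces := K.down_closed hAC (Finset.insert_subset
          (Finset.mem_union_right _ hu) Finset.subset_union_left) (Finset.insert_nonempty _ _)
        obtain ⟨B, hB⟩ := exists_weight_of_card (K.indep h1) (by
          rw [Finset.card_union_of_disjoint (hdisj.mono_right (by grind)), Finset.card_pair hpv]
          omega)
        obtain ⟨hg, hgb⟩ := hB (bary (Finsupp.single u 1))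
        set g := B (bary (Finsupp.single u 1)) with hgdef
        obtain ⟨b, hb, hmin⟩ := ({p, v, w} : Finset E).exists_min_image (fun b => g b / c b)
          (by simp)
        have hle : ∀ b' ∈ ({p, v, w} : Finset E), g b / c b * c b' ≤ g b' := fun b' hb' =>
          (le_div_iff₀ (hcB b' hb')).mp (hmin b' hb')
        have hsupp : SuppIn (g - (g b / c b) • c) (A ∪ ({p, v, w} : Finset E).erase b) := by
          intro x hx
          rw [Finsupp.sub_apply, Finsupp.smul_apply, smul_eq_mul]
          by_cases hxb : x = b
          · rw [hxb, div_mul_cancel₀ _ (hcB b hb).ne', sub_self]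
          · have h5 : x ∉ A ∪ {p, v, w} := by grind
            have h6 : x ∉ A ∪ {p, v} := by grind
            rw [hg x h6, hcs x h5]; ring
        have key := weights_unique_of_nonneg_off huK (herase b hb) (Finset.subset_insert _ _)
          Finset.subset_union_left (f := Finsupp.single u 1) (suppIn_single u 1 (by simp))
          (fun x _ => by rw [Finsupp.single_apply]; split_ifs <;> norm_num) hsupp
          (fun x hx => by
            by_cases hxB : x ∈ ({p, v, w} : Finset E)
            · have := hle x hxB
              rw [Finsupp.sub_apply, Finsupp.smul_apply, smul_eq_mul]; linarith
            · rw [hsupp x (by grind)])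
          (by rw [map_sub, map_smul, hc0, smul_zero, sub_zero, hgb])
        by_contra huB
        have h5 := DFunLike.congr_fun key u
        rw [Finsupp.single_eq_same, hsupp u (by grind)] at h5
        exact one_ne_zero h5
      · rw [h, hBcard] at hle
        omega
    · intro hC'
      obtain ⟨b, hb, hbC⟩ := Finset.exists_of_ssubset hC'
      exact K.down_closed (herase b hb) (Finset.union_subset_union_right
        (Finset.subset_erase.mpr ⟨hC'.1, hbC⟩)) (hAne.mono Finset.subset_union_left)
  obtain ⟨K', hf, -, hm⟩ := exists_bistellarMove (n := n) (c := -c) hA (B := {p, v, w}) (by simp)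
    (by omega) hdisj hlink
    (fun v hv => by simp only [Finsupp.neg_apply, neg_eq_zero]; exact hcs v hv)
    (by rw [map_neg, hc0, neg_zero])
    (fun v hv => by have := hcA v hv; simpa using this)
    (fun v hv => by have := hcB v hv; simpa using this)
  exact ⟨K', hm, hf.trans (flipFaces_eq_stellarFaces hA (by simp) hdisj hlink)⟩


/-- A flip whose new simplex contains `p` preserves the hypotheses of the induction for the
stellar subdivision. -/
lemma IsGenericFor.of_flip {K' : Geometry.SimplicialComplex ℝ E} {A F G : Finset E} {p : E}
    (hgen : IsGenericFor n K A p) (hf : K'.faces = flipFaces K.faces F G) (hpG : p ∈ G) :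
    IsGenericFor n K' A p := by
  intro T hT hAT hcard hpT
  rw [hf] at hT
  rcases hT with ⟨hT, -⟩ | ⟨F', -, rfl⟩
  · exact hgen T hT hAT hcard hpT
  · exact absurd (Finset.mem_union_right _ hpG) hpT

/-- A step of the generic stellar subdivision at a codimension-two face. -/
lemma exists_flip_codim_two (hn : Module.finrank ℝ E = n) (hK : K.faces.Finite)
    {A : Finset E} {p v : E} (hA : A ∈ K.faces) (hpA : p ∉ A)
    (hint : IsInteriorFace K A) (hgen : IsGenericFor n K A p) (hcard : A.card + 1 = n)
    (hv : v ∉ insert p A) (hvK : insert v (insert p A) ∈ K.faces) :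
    ∃ (w : E) (c : E →₀ ℝ), w ∉ A ∧ w ≠ p ∧ w ≠ v ∧ A ∪ {v, w} ∈ K.faces ∧
      SuppIn c (A ∪ {p, v, w}) ∧ bary c = 0 ∧ (∀ u ∈ A, c u < 0) ∧ c p = 1 ∧ 0 < c w ∧
      (0 < c v ∨ ∃ K' : Geometry.SimplicialComplex ℝ E, BistellarMove n K K' ∧
        K'.faces = flipFaces K.faces (insert v A) {p, w} ∧
        stellarFaces K'.faces A p = stellarFaces K.faces A p) := by
  have hvA : v ∉ A := fun h => hv (Finset.mem_insert_of_mem h)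
  have hvp : v ≠ p := fun h => hv (by simp [h])
  have hFK : insert v A ∈ K.faces := K.down_closed hvK
    (Finset.insert_subset_insert _ (Finset.subset_insert _ _)) (Finset.insert_nonempty _ _)
  have hFcard : (insert v A).card = n := by rw [Finset.card_insert_of_notMem hvA, hcard]
  have hpF : p ∉ insert v A := by simp [hvp.symm, hpA]
  obtain ⟨w, c, hwF, hwp, hwK, hcs, hcp, hcw, hc0, huniq⟩ :=
    (hint.mono (Finset.subset_insert v A)).exists_circuit hn hK hFK hFcard hpF
      (by rwa [Finset.insert_comm])
  have hwA : w ∉ A := fun h => hwF (Finset.mem_insert_of_mem h)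
  have hwv : w ≠ v := fun h => hwF (by simp [h])
  have hpT : p ∉ insert w (insert v A) := by simp [hwp.symm, hvp.symm, hpA]
  have hg := hgen _ hwK ((Finset.subset_insert _ _).trans (Finset.subset_insert _ _))
    (by rw [Finset.card_insert_of_notMem hwF, hFcard]) hpT (Finsupp.single p 1 - c)
    (fun u hu => by
      by_cases hup : u = p
      · subst hup; simp [hcp]
      · rw [Finsupp.sub_apply, Finsupp.single_eq_of_ne hup, hcs u (by rw [Finset.mem_insert]; tauto),
          sub_zero])
    (by rw [map_sub, hc0, bary_single, one_smul, sub_zero])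
  have hcA : ∀ u ∈ A, c u < 0 := fun u hu => by
    have := hg.2 u hu
    have hup : u ≠ p := fun e => hpA (e ▸ hu)
    rw [Finsupp.sub_apply, Finsupp.single_eq_of_ne hup] at this
    linarith
  have hcv : c v ≠ 0 := fun h => by
    have := hg.1 v (by simp)
    rw [Finsupp.sub_apply, Finsupp.single_eq_of_ne hvp, h, sub_zero] at this
    exact this rfl
  refine ⟨w, c, hwA, hwp, hwv, ?_, ?_, hc0, hcA, hcp, hcw, ?_⟩
  · convert hwK using 1; grind
  · convert hcs using 1; grind
  rcases lt_or_gt_of_ne hcv with hneg | hpos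
  swap
  · exact Or.inl hpos
  right
  have hdisj : Disjoint (insert v A) {p, w} := by
    rw [Finset.disjoint_right]
    intro u hu
    rcases Finset.mem_insert.mp hu with rfl | hu
    · exact hpF
    · rw [Finset.mem_singleton.mp hu]; exact hwF
  have hlink := link_eq_pair hn hFK hFcard hwp.symm (by rwa [Finset.insert_comm]) hwK huniq
  obtain ⟨K', hf, -, hm⟩ := exists_bistellarMove (n := n) (c := -c) hFK (B := {p, w}) (by simp)
    (by rw [Finset.card_pair hwp.symm, hFcard]) hdisj hlink
    (fun u hu => by
      simp only [Finsupp.neg_apply, neg_eq_zero]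
      refine hcs u ?_
      simp only [Finset.mem_union, Finset.mem_insert, Finset.mem_singleton] at hu ⊢
      tauto) (by rw [map_neg, hc0, neg_zero])
    (fun u hu => by
      rw [Finsupp.neg_apply, neg_pos]
      rcases Finset.mem_insert.mp hu with rfl | hu
      · exact hneg
      · exact hcA u hu)
    (fun u hu => by
      rw [Finsupp.neg_apply, neg_lt_zero]
      rcases Finset.mem_insert.mp hu with rfl | hu
      · simp [hcp]
      · rw [Finset.mem_singleton.mp hu]; exact hcw)
  refine ⟨K', hm, hf, ?_⟩
  rw [hf]
  exact stellarFaces_flipFaces (Finset.subset_insert _ _) (K.nonempty_of_mem_faces hA)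
    (by simp) hdisj hlink

/-- Generic stellar subdivision at a face of codimension at most two, the new vertex being already
a vertex of the complex adjacent to the face, is a sequence of flips. -/
theorem exists_stellar_of_insert_mem (hn : Module.finrank ℝ E = n) {A : Finset E} {p : E}
    (hpA : p ∉ A) (hcard : n ≤ A.card + 1) (m : ℕ) :
    ∀ K : Geometry.SimplicialComplex ℝ E, K.faces.Finite → A ∈ K.faces → insert p A ∈ K.faces →
      IsInteriorFace K A → IsGenericFor n K A p → {s ∈ K.faces | A ⊆ s ∧ p ∉ s}.ncard = m →
      ∃ K' : Geometry.SimplicialComplex ℝ E, Relation.ReflTransGen (BistellarMove n) K K' ∧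
        K'.faces = stellarFaces K.faces A p := by
  induction m using Nat.strong_induction_on with
  | _ m ih =>
  intro K hK hA hpAK hint hgen hm
  have hpcard := card_le_of_affineIndependent (K.indep hpAK)
  rw [Finset.card_insert_of_notMem hpA, hn] at hpcard
  by_cases hcn : A.card = n
  · obtain ⟨K', h, hf⟩ := exists_stellar_codim_one hn hK hA hpA hpAK hint hgen hcn
    exact ⟨K', Relation.ReflTransGen.single h, hf⟩
  replace hcn : A.card + 1 = n := by omega
  have hPcard : (insert p A).card = n := by rw [Finset.card_insert_of_notMem hpA, hcn]
  have hintP := hint.mono (Finset.subset_insert p A)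
  obtain ⟨v, hv, hvK⟩ := hintP.exists_insert_mem hn hK hpAK hPcard.le
  obtain ⟨v', -, hv', hvv', hv'K, -⟩ := hintP.exists_circuit hn hK hpAK hPcard hv hvK
  have step : ∀ (v w : E) (K₁ : Geometry.SimplicialComplex ℝ E), v ∉ insert p A →
      insert v (insert p A) ∈ K.faces → BistellarMove n K K₁ →
      K₁.faces = flipFaces K.faces (insert v A) {p, w} →
      stellarFaces K₁.faces A p = stellarFaces K.faces A p →
      ∃ K' : Geometry.SimplicialComplex ℝ E, Relation.ReflTransGen (BistellarMove n) K K' ∧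
        K'.faces = stellarFaces K.faces A p := by
    intro v w K₁ hv hvK hm₁ hf hst
    have hvA : v ∉ A := fun h => hv (Finset.mem_insert_of_mem h)
    have hFK : insert v A ∈ K.faces := K.down_closed hvK
      (Finset.insert_subset_insert _ (Finset.subset_insert _ _)) (Finset.insert_nonempty _ _)
    obtain ⟨K', h', hf'⟩ := ih {s ∈ K₁.faces | A ⊆ s ∧ p ∉ s}.ncard (by
        rw [← hm]
        refine Set.ncard_lt_ncard (Set.ssubset_iff_of_subset ?_ |>.mpr ⟨insert v A, ?_, ?_⟩)
          (hK.subset fun s hs => hs.1)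
        · rintro s ⟨hs, hAs, hps⟩
          rw [hf] at hs
          rcases hs with ⟨hs, -⟩ | ⟨F', -, rfl⟩
          · exact ⟨hs, hAs, hps⟩
          · exact absurd (by simp) hps
        · refine ⟨hFK, Finset.subset_insert _ _, fun h => ?_⟩
          rcases Finset.mem_insert.mp h with rfl | h
          · exact hv (Finset.mem_insert_self _ _)
          · exact hpA h
        · rintro ⟨hs, -, hps⟩
          rw [hf] at hs
          rcases hs with ⟨-, hs⟩ | ⟨F', -, h⟩
          · exact hs (Finset.Subset.refl _)
          · exact hps (h ▸ by simp)) K₁ (by rw [hf]; exact finite_flipFaces hK)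
      (by rw [hf]; exact Or.inl ⟨hA, fun h => hvA (h (Finset.mem_insert_self _ _))⟩)
      (by rw [hf]; exact Or.inl ⟨hpAK, fun h => hv (h (Finset.mem_insert_self _ _))⟩)
      (hint.congr_space (reflTransGen_space (Relation.ReflTransGen.single hm₁)))
      (hgen.of_flip hf (by simp)) rfl
    exact ⟨K', Relation.ReflTransGen.head hm₁ h', hf'.trans hst⟩
  obtain ⟨w, c, hwA, hwp, hwv, hvwK, hcs, hc0, hcA, hcp, hcw, hcv | ⟨K₁, hm₁, hf, hst⟩⟩ :=
    exists_flip_codim_two hn hK hA hpA hint hgen hcn hv hvK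
  swap
  · exact step v w K₁ hv hvK hm₁ hf hst
  obtain ⟨w', c', hwA', hwp', hwv', hvwK', hcs', hc0', hcA', hcp', hcw',
      hcv' | ⟨K₁, hm₁, hf, hst⟩⟩ :=
    exists_flip_codim_two hn hK hA hpA hint hgen hcn hv' hv'K
  swap
  · exact step v' w' K₁ hv' hv'K hm₁ hf hst
  have hvA : v ∉ A := fun h => hv (Finset.mem_insert_of_mem h)
  have hvp : v ≠ p := fun h => hv (by simp [h])
  have hvA' : v' ∉ A := fun h => hv' (Finset.mem_insert_of_mem h)
  have hvp' : v' ≠ p := fun h => hv' (by simp [h])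
  have supp : ∀ (c : E →₀ ℝ) (v w : E), SuppIn c (A ∪ {p, v, w}) → c p = 1 →
      SuppIn (c - Finsupp.single p 1) (A ∪ {v, w}) := by
    intro c v w hcs hcp u hu
    by_cases hup : u = p
    · subst hup; simp [hcp]
    · rw [Finsupp.sub_apply, Finsupp.single_eq_of_ne hup, hcs u (by grind), sub_zero]
  have nonneg : ∀ (c : E →₀ ℝ) (v w : E), SuppIn c (A ∪ {p, v, w}) → c p = 1 → 0 < c v →
      0 < c w → ∀ u, u ∉ A → 0 ≤ (c - Finsupp.single p 1 : E →₀ ℝ) u := by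
    intro c v w hcs hcp hcv hcw u hu
    by_cases hup : u = p
    · subst hup; simp [hcp]
    · rw [Finsupp.sub_apply, Finsupp.single_eq_of_ne hup, sub_zero]
      by_cases huv : u = v
      · subst huv; exact hcv.le
      · by_cases huw : u = w
        · subst huw; exact hcw.le
        · rw [hcs u (by grind)]
  have key := weights_unique_of_nonneg_off hvwK hvwK' Finset.subset_union_left
    Finset.subset_union_left (supp c v w hcs hcp) (nonneg c v w hcs hcp hcv hcw)
    (supp c' v' w' hcs' hcp') (nonneg c' v' w' hcs' hcp' hcv' hcw')
    (by rw [map_sub, map_sub, hc0, hc0'])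
  have hwv'' : v' = w := by
    by_contra hne
    have h1 := DFunLike.congr_fun key v'
    rw [supp c v w hcs hcp v' (by grind), Finsupp.sub_apply, Finsupp.single_eq_of_ne hvp'] at h1
    linarith
  subst hwv''
  obtain ⟨K', h, hf⟩ := exists_stellar_of_triangle hn hA hcn hpA hvA hwA hvp.symm hwp.symm hwv.symm
    (by convert hvK using 1; grind) (by convert hv'K using 1; grind) hvwK hcs hc0 hcA
    (fun u hu => by
      simp only [Finset.mem_insert, Finset.mem_singleton] at hu
      rcases hu with rfl | rfl | rfl
      · rw [hcp]; exact one_pos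
      · exact hcv
      · exact hcw)
  exact ⟨K', Relation.ReflTransGen.single h, hf⟩

/-- Generic stellar subdivision at a face of codimension at most two is a sequence of flips. -/
theorem exists_stellar (hn : Module.finrank ℝ E = n) (hK : K.faces.Finite) {A : Finset E} {p : E}
    (hcard : n ≤ A.card + 1) (hA : A ∈ K.faces) (hint : IsInteriorFace K A)
    (hgen : IsGenericFor n K A p) {T : Finset E} (hT : T ∈ K.faces) (hAT : A ⊆ T)
    (hTcard : T.card = n + 1) (hpT : p ∉ T) {g : E →₀ ℝ} (hgs : SuppIn g T)
    (hgb : bary g = (p, 1)) (hg : ∀ v ∈ T, 0 < g v) :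
    ∃ K' : Geometry.SimplicialComplex ℝ E, Relation.ReflTransGen (BistellarMove n) K K' ∧
      K'.faces = stellarFaces K.faces A p := by
  have hpA : p ∉ A := fun h => hpT (hAT h)
  have hAne := K.nonempty_of_mem_faces hA
  have hdisj : Disjoint T {p} := Finset.disjoint_singleton_right.mpr hpT
  have hlink : ∀ C, Disjoint T C → (T ∪ C ∈ K.faces ↔ C ⊂ {p}) := by
    intro C hC
    rw [Finset.ssubset_singleton_iff]
    constructor
    · intro h
      have h1 := card_le_of_affineIndependent (K.indep h)
      rw [Finset.card_union_of_disjoint hC, hn] at h1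
      exact Finset.card_eq_zero.mp (by omega)
    · rintro rfl
      simpa using hT
  obtain ⟨K₁, hf, hsp, hm⟩ := exists_bistellarMove (n := n) (c := g - Finsupp.single p 1) hT
    (B := {p}) (by simp) (by simp [hTcard]) hdisj hlink
    (fun v hv => by
      rw [Finset.mem_union, not_or, Finset.mem_singleton] at hv
      rw [Finsupp.sub_apply, hgs v hv.1, Finsupp.single_eq_of_ne hv.2, sub_zero])
    (by rw [map_sub, hgb, bary_single, one_smul, sub_self])
    (fun v hv => by
      have hvp : v ≠ p := fun e => hpT (e ▸ hv)
      rw [Finsupp.sub_apply, Finsupp.single_eq_of_ne hvp, sub_zero]; exact hg v hv)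
    (fun v hv => by
      rw [Finset.mem_singleton.mp hv, Finsupp.sub_apply, hgs p hpT, Finsupp.single_eq_same]
      norm_num)
  by_cases hATe : A = T
  · subst hATe
    exact ⟨K₁, Relation.ReflTransGen.single hm,
      hf.trans (flipFaces_eq_stellarFaces hA (by simp) hdisj hlink)⟩
  have hss : A ⊂ T := Finset.ssubset_iff_subset_ne.mpr ⟨hAT, hATe⟩
  obtain ⟨K', h', hf'⟩ := exists_stellar_of_insert_mem hn hpA hcard _ K₁
    (by rw [hf]; exact finite_flipFaces hK)
    (by rw [hf]; exact Or.inl ⟨hA, fun h => hss.2 h⟩)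
    (by rw [hf]; exact Or.inr ⟨A, hss, by rw [Finset.union_comm, Finset.insert_eq]⟩)
    (hint.congr_space hsp) (hgen.of_flip hf (by simp)) rfl
  refine ⟨K', Relation.ReflTransGen.head hm h', hf'.trans ?_⟩
  rw [hf]
  exact stellarFaces_flipFaces hAT hAne (by simp) hdisj hlink

end GenericStellar

section Perturbation

variable {K : Geometry.SimplicialComplex ℝ E} {n : ℕ} [FiniteDimensional ℝ E]

lemma eventually_pos_of_continuous {f : ℝ → ℝ} (hf : Continuous f) (h0 : 0 < f 0) :
    ∀ᶠ ε in nhdsWithin (0 : ℝ) (Set.Ioi 0), 0 < f ε :=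
  nhdsWithin_le_nhds (hf.tendsto 0 |>.eventually (lt_mem_nhds h0))

/-- There is a direction which is in general position with respect to all top-dimensional faces
containing `A`, and whose coordinate at `x`, relative to the weight `α`, dominates the other
coordinates on `A`. -/
lemma exists_generic_direction (hn : Module.finrank ℝ E = n) (hK : K.faces.Finite)
    {A : Finset E} {α : E →₀ ℝ} {a x : E} (hα : SuppIn α A) (hpos : ∀ v ∈ A, 0 < α v)
    (hb : bary α = (a, 1)) (hx : x ∈ A) :
    ∃ d : E, ∀ T ∈ K.faces, A ⊆ T → T.card = n + 1 → ∀ g, SuppIn g T → bary g = (d, 0) →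
      (∀ c ∈ T, c ∉ A → g c ≠ 0) ∧ (∀ y ∈ A, y ≠ x → g y / α y < g x / α x) ∧
      ∀ y ∈ A, ∀ z ∈ A, y ≠ z → g y / α y ≠ g z / α z := by
  set 𝒯 : Set (Finset E) := {T ∈ K.faces | A ⊆ T ∧ T.card = n + 1} with h𝒯
  have hfin : 𝒯.Finite := hK.subset fun T hT => hT.1
  have : Finite 𝒯 := hfin
  have hex : ∀ T : 𝒯, ∃ D : E →ₗ[ℝ] (E →₀ ℝ), ∀ d, SuppIn (D d) T.1 ∧ bary (D d) = (d, 0) := by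
    intro T
    obtain ⟨B, hB⟩ := exists_weight_of_card (K.indep T.2.1) (by rw [T.2.2.2, hn])
    exact ⟨B.comp (LinearMap.inl ℝ E ℝ), fun d => hB (d, 0)⟩
  choose D hD using hex
  have hDc : ∀ (T : 𝒯) (c : E), c ∈ T.1 → D T (c - a) = Finsupp.single c 1 - α := by
    intro T c hc
    refine eq_of_bary_eq (K.indep T.2.1) (hD T _).1 (fun v hv => ?_) ?_
    · rw [Finsupp.sub_apply, suppIn_single c 1 hc v hv, hα v (fun h => hv (T.2.2.1 h)), sub_zero]
    · rw [(hD T _).2, map_sub, bary_single, hb]; simp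
  let φ : (Σ T : 𝒯, {c : T.1 // c.1 ∉ A}) ⊕ (𝒯 × {p : A × A // p.1 ≠ p.2}) → Module.Dual ℝ E
    | Sum.inl ⟨T, c⟩ => LinearMap.comp (Finsupp.lapply (R := ℝ) c.1.1 : (E →₀ ℝ) →ₗ[ℝ] ℝ) (D T)
    | Sum.inr (T, p) => LinearMap.comp
        (((α p.1.1.1)⁻¹ • (Finsupp.lapply (R := ℝ) p.1.1.1 : (E →₀ ℝ) →ₗ[ℝ] ℝ)) -
          (α p.1.2.1)⁻¹ • (Finsupp.lapply (R := ℝ) p.1.2.1 : (E →₀ ℝ) →ₗ[ℝ] ℝ)) (D T)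
  obtain ⟨e, he⟩ := Module.Dual.exists_forall_ne_zero_of_forall_exists φ (by
    rintro (⟨T, ⟨⟨c, hc⟩, hcA⟩⟩ | ⟨T, ⟨⟨⟨y, hy⟩, ⟨z, hz⟩⟩, hyz⟩⟩)
    · refine ⟨c - a, ?_⟩
      simp [φ, hDc T c hc, hα c hcA]
    · have hyz : y ≠ z := fun h => hyz (Subtype.ext h)
      refine ⟨y - a, ?_⟩
      have h1 := (hpos y hy).ne'
      have h2 := (hpos z hz).ne'
      simp only [φ, LinearMap.comp_apply, hDc T y (T.2.2.1 hy), LinearMap.sub_apply,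
        LinearMap.smul_apply, Finsupp.lapply_apply, Finsupp.sub_apply, Finsupp.single_eq_same,
        Finsupp.single_eq_of_ne hyz.symm, smul_eq_mul, mul_sub, inv_mul_cancel₀ h1,
        inv_mul_cancel₀ h2]
      exact fun h => inv_ne_zero h1 (by linarith))
  have he1 : ∀ (T : 𝒯) (c : E), c ∈ T.1 → c ∉ A → D T e c ≠ 0 := fun T c hc hcA =>
    he (Sum.inl ⟨T, ⟨⟨c, hc⟩, hcA⟩⟩)
  have he2 : ∀ (T : 𝒯) (y z : E), y ∈ A → z ∈ A → y ≠ z → D T e y / α y ≠ D T e z / α z := by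
    intro T y z hy hz hyz h
    refine he (Sum.inr (T, ⟨⟨⟨y, hy⟩, ⟨z, hz⟩⟩, fun h => hyz (congrArg Subtype.val h)⟩)) ?_
    simp only [φ, LinearMap.comp_apply, LinearMap.sub_apply,
      LinearMap.smul_apply, Finsupp.lapply_apply, smul_eq_mul]
    rw [div_eq_inv_mul, div_eq_inv_mul] at h
    exact sub_eq_zero.mpr h
  have hev : ∀ᶠ δ in nhdsWithin (0 : ℝ) (Set.Ioi 0), ∀ T : 𝒯, ∀ y : A,
      0 < 1 / α x + δ * (D T e x / α x) - δ * (D T e y.1 / α y.1) := by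
    rw [Filter.eventually_all]
    intro T
    rw [Filter.eventually_all]
    intro y
    refine eventually_pos_of_continuous (by fun_prop) ?_
    have := hpos x hx
    simpa using this
  obtain ⟨δ, hδ, hδ0⟩ := (hev.and self_mem_nhdsWithin).exists
  have hδ0 : 0 < δ := hδ0
  refine ⟨(x - a) + δ • e, fun T hT hAT hTc g hg hgb => ?_⟩
  have hgD : g = (Finsupp.single x 1 - α) + δ • D ⟨T, hT, hAT, hTc⟩ e := by
    rw [← hDc ⟨T, hT, hAT, hTc⟩ x (hAT hx), ← map_smul, ← map_add]
    exact eq_of_bary_eq (K.indep hT) hg (hD ⟨T, hT, hAT, hTc⟩ _).1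
      (hgb.trans (hD ⟨T, hT, hAT, hTc⟩ _).2.symm)
  set T' : 𝒯 := ⟨T, hT, hAT, hTc⟩ with hT'
  have hgx : g x / α x = 1 / α x - 1 + δ * (D T' e x / α x) := by
    have := (hpos x hx).ne'
    rw [hgD]
    simp only [Finsupp.add_apply, Finsupp.sub_apply, Finsupp.single_eq_same, Finsupp.smul_apply,
      smul_eq_mul]
    field_simp
  have hgy : ∀ y ∈ A, y ≠ x → g y / α y = -1 + δ * (D T' e y / α y) := by
    intro y hy hyx
    have := (hpos y hy).ne'
    rw [hgD]
    simp only [Finsupp.add_apply, Finsupp.sub_apply, Finsupp.single_eq_of_ne hyx,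
      Finsupp.smul_apply, smul_eq_mul]
    field_simp
    ring
  have hlt : ∀ y ∈ A, y ≠ x → g y / α y < g x / α x := by
    intro y hy hyx
    have := hδ T' ⟨y, hy⟩
    rw [hgx, hgy y hy hyx]
    simp only at this
    linarith
  refine ⟨fun c hc hcA => ?_, hlt, fun y hy z hz hyz => ?_⟩
  · have hcx : c ≠ x := fun h => hcA (h ▸ hx)
    rw [hgD]
    simp only [Finsupp.add_apply, Finsupp.sub_apply, Finsupp.single_eq_of_ne hcx, hα c hcA,
      Finsupp.smul_apply, smul_eq_mul]
    simpa using ⟨hδ0.ne', he1 T' c hc hcA⟩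
  · by_cases hyx : y = x
    · subst hyx; exact (hlt z hz hyz.symm).ne'
    · by_cases hzx : z = x
      · subst hzx; exact (hlt y hy hyz).ne
      · rw [hgy y hy hyx, hgy z hz hzx]
        intro h
        have := mul_left_cancel₀ hδ0.ne' (add_left_cancel h)
        exact he2 T' y z hy hz hyz this

/-- Every face containing an interior face is contained in a top-dimensional face. -/
lemma IsInteriorFace.exists_top (hn : Module.finrank ℝ E = n) (hK : K.faces.Finite)
    {A : Finset E} (hint : IsInteriorFace K A) {s : Finset E} (hs : s ∈ K.faces) (hAs : A ⊆ s) :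
    ∃ T ∈ K.faces, s ⊆ T ∧ T.card = n + 1 := by
  have hle := card_le_of_affineIndependent (K.indep hs)
  rw [hn] at hle
  induction hk : n + 1 - s.card generalizing s with
  | zero => exact ⟨s, hs, Finset.Subset.refl s, by omega⟩
  | succ k ih =>
    obtain ⟨v, hv, hvs⟩ := (hint.mono hAs).exists_insert_mem hn hK hs (by omega)
    have hc : (insert v s).card = s.card + 1 := Finset.card_insert_of_notMem hv
    obtain ⟨T, hT, hsT, hTc⟩ := ih hvs (hAs.trans (Finset.subset_insert v s)) (by omega) (by omega)
    exact ⟨T, hT, (Finset.subset_insert v s).trans hsT, hTc⟩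

/-- The perturbed point `b` is in general position, relative to the weight `α` on `A`, with respect
to all top-dimensional faces containing `A`. -/
lemma exists_generic_point (hn : Module.finrank ℝ E = n) (hK : K.faces.Finite)
    {A : Finset E} (hA : A ∈ K.faces) (hint : IsInteriorFace K A) {α : E →₀ ℝ} {a x : E}
    (hα : SuppIn α A) (hpos : ∀ v ∈ A, 0 < α v) (hb : bary α = (a, 1)) (hx : x ∈ A) :
    ∃ b : E, (∀ T ∈ K.faces, A ⊆ T → T.card = n + 1 → ∀ β, SuppIn β T → bary β = (b, 1) →
        (∀ v ∈ A, 0 < β v) ∧ (∀ c ∈ T, c ∉ A → β c ≠ 0) ∧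
        (∀ y ∈ A, y ≠ x → β y / α y < β x / α x) ∧
        ∀ y ∈ A, ∀ z ∈ A, y ≠ z → β y / α y ≠ β z / α z) ∧
      (∃ T ∈ K.faces, A ⊆ T ∧ T.card = n + 1 ∧ ∃ β, SuppIn β T ∧ bary β = (b, 1) ∧
        ∀ v ∈ T, 0 < β v) ∧
      ∃ T ∈ K.faces, A ⊆ T ∧ T.card = n + 1 ∧ ∃ β, SuppIn β T ∧ bary β = (b, 1) ∧
        ∀ c ∈ T, c ∉ A → β c < 0 := by
  obtain ⟨d, hd⟩ := exists_generic_direction hn hK hα hpos hb hx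
  set 𝒯 : Set (Finset E) := {T ∈ K.faces | A ⊆ T ∧ T.card = n + 1} with h𝒯
  have hfin : 𝒯.Finite := hK.subset fun T hT => hT.1
  have : Finite 𝒯 := hfin
  have hex : ∀ T : 𝒯, ∃ g : E →₀ ℝ, SuppIn g T.1 ∧ bary g = (d, 0) := by
    intro T
    obtain ⟨B, hB⟩ := exists_weight_of_card (K.indep T.2.1) (by rw [T.2.2.2, hn])
    exact ⟨_, hB (d, 0)⟩
  choose g hg using hex
  have hev : ∀ᶠ ε in nhdsWithin (0 : ℝ) (Set.Ioi 0), ∀ T : 𝒯, ∀ v : A,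
      0 < α v.1 + ε * g T v.1 := by
    rw [Filter.eventually_all]
    intro T
    rw [Filter.eventually_all]
    intro y
    refine eventually_pos_of_continuous (by fun_prop) ?_
    have := hpos y.1 y.2
    simpa using this
  obtain ⟨ε, hε, hε0⟩ := (hev.and self_mem_nhdsWithin).exists
  have hε0 : 0 < ε := hε0
  have hsupp : ∀ T : 𝒯, SuppIn (α + ε • g T) T.1 := fun T v hv => by
    rw [Finsupp.add_apply, Finsupp.smul_apply, hα v (fun h => hv (T.2.2.1 h)), (hg T).1 v hv]
    simp
  have hbary : ∀ T : 𝒯, bary (α + ε • g T) = (a + ε • d, 1) := fun T => by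
    rw [map_add, map_smul, hb, (hg T).2]; simp
  have hβA : ∀ T : 𝒯, ∀ v ∈ A, 0 < (α + ε • g T : E →₀ ℝ) v := fun T v hv => by
    simpa using hε T ⟨v, hv⟩
  have hβc : ∀ T : 𝒯, ∀ c, c ∉ A → (α + ε • g T : E →₀ ℝ) c = ε * g T c := fun T c hc => by
    simp [hα c hc]
  have hne : ∀ T : 𝒯, ∀ c ∈ T.1, c ∉ A → g T c ≠ 0 := fun T =>
    (hd T.1 T.2.1 T.2.2.1 T.2.2.2 _ (hg T).1 (hg T).2).1
  have hside : ∀ r : ℝ, ∃ T : 𝒯, ∃ f : E →₀ ℝ, (∀ v, v ∉ A → 0 ≤ f v) ∧ f = r • g T := by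
    intro r
    obtain ⟨s, hs, hAs, f, hf, hf0, hfb⟩ := hint.exists_weight hK hA (r • (d, (0 : ℝ)))
    obtain ⟨T, hT, hsT, hTc⟩ := hint.exists_top hn hK hs hAs
    refine ⟨⟨T, hT, hAs.trans hsT, hTc⟩, f, hf0, ?_⟩
    refine eq_of_bary_eq (K.indep hT) (hf.mono hsT) (fun v hv => ?_) ?_
    · rw [Finsupp.smul_apply, (hg _).1 v hv, smul_zero]
    · rw [hfb, map_smul, (hg _).2]
  refine ⟨a + ε • d, fun T hT hAT hTc β hβ hβb => ?_, ?_, ?_⟩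
  · set T' : 𝒯 := ⟨T, hT, hAT, hTc⟩ with hT'
    have hβe : β = α + ε • g T' :=
      eq_of_bary_eq (K.indep hT) hβ (hsupp T') (hβb.trans (hbary T').symm)
    obtain ⟨-, h2, h3⟩ := hd T hT hAT hTc _ (hg T').1 (hg T').2
    have hrat : ∀ y ∈ A, β y / α y = 1 + ε * (g T' y / α y) := fun y hy => by
      have := (hpos y hy).ne'
      rw [hβe]
      simp only [Finsupp.add_apply, Finsupp.smul_apply, smul_eq_mul]
      field_simp
    refine ⟨fun v hv => hβe ▸ hβA T' v hv, fun c hc hcA => ?_, fun y hy hyx => ?_,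
      fun y hy z hz hyz => ?_⟩
    · rw [hβe, hβc T' c hcA]
      exact mul_ne_zero hε0.ne' (hne T' c hc hcA)
    · rw [hrat y hy, hrat x hx]
      have := mul_lt_mul_of_pos_left (h2 y hy hyx) hε0
      linarith
    · rw [hrat y hy, hrat z hz]
      exact fun h => h3 y hy z hz hyz (mul_left_cancel₀ hε0.ne' (add_left_cancel h))
  · obtain ⟨T, f, hf0, hf⟩ := hside 1
    refine ⟨T.1, T.2.1, T.2.2.1, T.2.2.2, _, hsupp T, hbary T, fun v hv => ?_⟩
    by_cases hvA : v ∈ A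
    · exact hβA T v hvA
    · rw [hβc T v hvA]
      have h1 := hf0 v hvA
      rw [hf, one_smul] at h1
      exact mul_pos hε0 (lt_of_le_of_ne h1 (hne T v hv hvA).symm)
  · obtain ⟨T, f, hf0, hf⟩ := hside (-1)
    refine ⟨T.1, T.2.1, T.2.2.1, T.2.2.2, _, hsupp T, hbary T, fun v hv hvA => ?_⟩
    rw [hβc T v hvA]
    have h1 := hf0 v hvA
    rw [hf] at h1
    have h2 : g T v ≤ 0 := by simpa using h1
    exact mul_neg_of_pos_of_neg hε0 (lt_of_le_of_ne h2 (hne T v hv hvA))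

end Perturbation

section StellarSubdivision

variable {K L : Geometry.SimplicialComplex ℝ E} {A : Finset E} {p q : E}

/-- A relative interior point of a face with at least two vertices is not a vertex. -/
lemma notMem_of_pos {T : Finset E} (hT : T ∈ K.faces) (hcard : 1 < T.card) {w : E →₀ ℝ}
    (hw : SuppIn w T) (hpos : ∀ v ∈ T, 0 < w v) (hb : bary w = (p, 1)) :
    ∀ s ∈ K.faces, p ∉ s := by
  intro s hs hps
  have h1 : w = Finsupp.single p 1 := weights_unique hT hs hw (wnonneg_of_pos hw hpos)
    (suppIn_single p 1 hps) (fun v => by rw [Finsupp.single_apply]; split_ifs <;> norm_num)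
    (by rw [hb, bary_single, one_smul])
  obtain ⟨y, hy, hyp⟩ := Finset.exists_mem_ne hcard p
  have := hpos y hy
  rw [h1, Finsupp.single_eq_of_ne hyp] at this
  exact lt_irrefl _ this

lemma isInteriorFace_of_subset {B : Finset E} (hB : B.Nonempty) {S : Set E} (hS : Convex ℝ S)
    (hBS : (B : Set E) ⊆ S) (hSi : S ⊆ interior K.space) : IsInteriorFace K B := by
  have hc : (0 : ℝ) < B.card := Nat.cast_pos.mpr hB.card_pos
  have hval : ∀ v ∈ B, weightOn B (fun _ => (B.card : ℝ)⁻¹) v = (B.card : ℝ)⁻¹ := fun v hv => by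
    rw [weightOn_apply, if_pos hv]
  have hsum : ∑ v ∈ B, weightOn B (fun _ => (B.card : ℝ)⁻¹) v = 1 := by
    rw [Finset.sum_congr rfl hval, Finset.sum_const, nsmul_eq_mul, mul_inv_cancel₀ hc.ne']
  refine ⟨weightOn B fun _ => (B.card : ℝ)⁻¹, _, suppIn_weightOn _ _, fun v hv => ?_,
    (bary_eq_sum (suppIn_weightOn _ _)).trans (by rw [hsum]), hSi ?_⟩
  · rw [hval v hv]; positivity
  · refine hS.sum_mem (fun v hv => ?_) hsum fun v hv => hBS hv
    rw [hval v hv]; positivity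

lemma insert_erase_mem_stellarFaces {T : Finset E} (hT : T ∈ K.faces) (hAT : A ⊆ T) {y : E}
    (hy : y ∈ A) : insert p (T.erase y) ∈ stellarFaces K.faces A p := by
  refine Or.inr ⟨A.erase y, T \ A, Finset.erase_ssubset hy, Finset.disjoint_sdiff, ?_, ?_⟩
  · rwa [Finset.union_sdiff_of_subset hAT]
  · congr 1
    ext v
    simp only [Finset.mem_erase, Finset.mem_union, Finset.mem_sdiff]
    have := @hAT v
    by_cases hv : v = y
    · subst hv; tauto
    · tauto

lemma space_subset_of_stellarFaces (hL : L.faces = stellarFaces K.faces A p) (hA : A.Nonempty)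
    {α : E →₀ ℝ} (hα : SuppIn α A) (hpos : ∀ v ∈ A, 0 < α v) (hb : bary α = (p, 1)) :
    K.space ⊆ L.space := by
  intro z hz
  obtain ⟨s, hs, w, hw, hw0, hwb⟩ := mem_space_iff_bary.mp hz
  rw [mem_space_iff_bary, hL]
  by_cases hAs : A ⊆ s
  · obtain ⟨τ, hτ, hle, y, hy, hyt⟩ := exists_tight_ratio hA (fun v _ => hw0 v) hpos
    refine ⟨_, insert_erase_mem_stellarFaces hs hAs hy, w - τ • α + Finsupp.single p τ,
      fun v hv => ?_, fun v => ?_, ?_⟩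
    · simp only [Finset.mem_insert, Finset.mem_erase, not_or, not_and_or, not_not] at hv
      rw [Finsupp.add_apply, Finsupp.sub_apply, Finsupp.single_eq_of_ne hv.1, Finsupp.smul_apply,
        smul_eq_mul]
      rcases hv.2 with rfl | h
      · linarith
      · rw [hw v h, hα v fun h' => h (hAs h')]; ring
    · rw [Finsupp.add_apply, Finsupp.sub_apply, Finsupp.smul_apply, smul_eq_mul,
        Finsupp.single_apply]
      have h1 : (0 : ℝ) ≤ if p = v then τ else 0 := by split_ifs <;> simp [hτ]
      have h2 : τ * α v ≤ w v := by
        by_cases hv : v ∈ A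
        · exact hle v hv
        · rw [hα v hv, mul_zero]; exact hw0 v
      linarith
    · rw [map_add, map_sub, map_smul, bary_single, hwb, hb]
      ext <;> simp
  · exact ⟨s, Or.inl ⟨hs, hAs⟩, w, hw, hw0, hwb⟩

/-- Exchanging the vertex `y` for `q` in the support of a weight. -/
lemma exists_exchange {T : Finset E} {f g : E →₀ ℝ} {y : E} (hf : SuppIn f T)
    (hfb : bary f = (p, 1)) (hg : SuppIn g T) (hgb : bary g = (q, 1)) (hgy : g y ≠ 0)
    (hqT : q ∉ T) : ∃ h : E →₀ ℝ, SuppIn h (insert q (T.erase y)) ∧ bary h = (p, 1) ∧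
      h q = f y / g y ∧ ∀ v ∈ T, h v = f v - f y / g y * g v := by
  refine ⟨f - (f y / g y) • (g - Finsupp.single q 1), fun v hv => ?_, ?_, ?_, fun v hv => ?_⟩
  · simp only [Finset.mem_insert, Finset.mem_erase, not_or, not_and_or, not_not] at hv
    simp only [Finsupp.sub_apply, Finsupp.smul_apply, smul_eq_mul, Finsupp.single_eq_of_ne hv.1]
    rcases hv.2 with rfl | h
    · field_simp; ring
    · rw [hf v h, hg v h]; ring
  · rw [map_sub, map_smul, map_sub, bary_single, hfb, hgb]
    ext <;> simp
  · simp [hf q hqT, hg q hqT]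
  · have : v ≠ q := fun h => hqT (h ▸ hv)
    simp [Finsupp.single_eq_of_ne this]

variable [FiniteDimensional ℝ E] {n : ℕ}

/-- The top-dimensional faces of a stellar subdivision containing the new vertex. -/
lemma exists_top_of_mem_stellarFaces (hn : Module.finrank ℝ E = n) (hp : ∀ s ∈ K.faces, p ∉ s)
    {T : Finset E} (hT : T ∈ stellarFaces K.faces A p) (hpT : p ∈ T) (hcard : T.card = n + 1) :
    ∃ S ∈ K.faces, A ⊆ S ∧ S.card = n + 1 ∧ ∃ y ∈ A, T = insert p (S.erase y) := by
  obtain ⟨A', C, hA', hC, hAC, rfl⟩ := (mem_stellarFaces_of_mem hp hpT).mp hT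
  obtain ⟨y, hy, hyA'⟩ := Finset.exists_of_ssubset hA'
  have hle := card_le_of_affineIndependent (K.indep hAC)
  rw [hn] at hle
  have hyC : y ∉ C := Finset.disjoint_left.mp hC hy
  have hsub : insert p (A' ∪ C) ⊆ insert p ((A ∪ C).erase y) := by
    refine Finset.insert_subset_insert p fun v hv => ?_
    rw [Finset.mem_erase]
    refine ⟨?_, Finset.union_subset_union_left hA'.1 hv⟩
    rintro rfl
    exact (Finset.mem_union.mp hv).elim hyA' hyC
  have h1 := Finset.card_insert_le p ((A ∪ C).erase y)
  have h2 := Finset.card_erase_add_one (Finset.mem_union_left C hy)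
  have h3 := Finset.card_le_card hsub
  exact ⟨A ∪ C, hAC, Finset.subset_union_left, by omega, y, hy,
    Finset.eq_of_subset_of_card_le hsub (by omega)⟩

/-- Generic stellar subdivision with new vertex `p` of a complex obtained by a stellar subdivision
with new vertex `q`. -/
lemma exists_stellar_of_stellarFaces (hn : Module.finrank ℝ E = n) (hK : K.faces.Finite)
    (hL : L.faces = stellarFaces K.faces A q) (hp : ∀ s ∈ K.faces, p ∉ s)
    (hq : ∀ s ∈ K.faces, q ∉ s) (hpq : p ≠ q) {B : Finset E} (hB : B ∈ L.faces) (hqB : q ∈ B)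
    (hcard : n ≤ B.card + 1) (hint : IsInteriorFace L B)
    (hgen : ∀ T ∈ K.faces, A ⊆ T → T.card = n + 1 → ∃ f g, SuppIn f T ∧ bary f = (p, 1) ∧
      SuppIn g T ∧ bary g = (q, 1) ∧ (∀ y ∈ A, 0 < f y ∧ 0 < g y) ∧
      ∀ y ∈ A, B ⊆ insert q (T.erase y) → ∀ v ∈ T, v ≠ y →
        f v - f y / g y * g v ≠ 0 ∧ (v ∈ B → 0 < f v - f y / g y * g v))
    (hpos : ∃ T ∈ K.faces, A ⊆ T ∧ T.card = n + 1 ∧ ∃ f g, SuppIn f T ∧ bary f = (p, 1) ∧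
      SuppIn g T ∧ bary g = (q, 1) ∧ ∃ y ∈ A, 0 < f y ∧ 0 < g y ∧ B ⊆ insert q (T.erase y) ∧
        ∀ v ∈ T, v ≠ y → 0 < f v - f y / g y * g v) :
    ∃ M : Geometry.SimplicialComplex ℝ E, Relation.ReflTransGen (BistellarMove n) L M ∧
      M.faces = stellarFaces L.faces B p := by
  obtain ⟨T, hT, hAT, hTc, f, g, hf, hfb, hg, hgb, y, hy, hfy, hgy, hBT, hfg⟩ := hpos
  obtain ⟨h, hh, hhb, hhq, hhv⟩ := exists_exchange hf hfb hg hgb hgy.ne' (hq T hT)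
  refine exists_stellar hn (hL ▸ finite_stellarFaces hK) hcard hB hint ?_
    (hL ▸ insert_erase_mem_stellarFaces hT hAT hy) hBT ?_ ?_ hh hhb ?_
  · intro S hS hBS hSc _ w hw hwb
    obtain ⟨T, hT, hAT, hTc, y, hy, rfl⟩ :=
      exists_top_of_mem_stellarFaces hn hq (hL ▸ hS) (hBS hqB) hSc
    obtain ⟨f, g, hf, hfb, hg, hgb, hfgA, hfg⟩ := hgen T hT hAT hTc
    obtain ⟨h, hh, hhb, hhq, hhv⟩ := exists_exchange hf hfb hg hgb (hfgA y hy).2.ne' (hq T hT)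
    obtain rfl : w = h := eq_of_bary_eq (L.indep hS) hw hh (hwb.trans hhb.symm)
    have hw0 : 0 < w q := hhq ▸ div_pos (hfgA y hy).1 (hfgA y hy).2
    refine ⟨fun v hv => ?_, fun v hv => ?_⟩
    · rcases Finset.mem_insert.mp hv with rfl | hv
      · exact hw0.ne'
      · obtain ⟨hvy, hvT⟩ := Finset.mem_erase.mp hv
        rw [hhv v hvT]
        exact (hfg y hy hBS v hvT hvy).1
    · rcases Finset.mem_insert.mp (hBS hv) with rfl | hv'
      · exact hw0
      · obtain ⟨hvy, hvT⟩ := Finset.mem_erase.mp hv'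
        rw [hhv v hvT]
        exact (hfg y hy hBS v hvT hvy).2 hv
  · rw [Finset.card_insert_of_notMem fun h => hq T hT (Finset.mem_of_mem_erase h),
      Finset.card_erase_of_mem (hAT hy), hTc]
    rfl
  · rw [Finset.mem_insert, not_or]
    exact ⟨hpq, fun h => hp T hT (Finset.mem_of_mem_erase h)⟩
  · intro v hv
    rcases Finset.mem_insert.mp hv with rfl | hv
    · exact hhq ▸ div_pos hfy hgy
    · obtain ⟨hvy, hvT⟩ := Finset.mem_erase.mp hv
      rw [hhv v hvT]
      exact hfg v hvT hvy

/-- In dimension at most three, stellar subdivisions at interior simplices of positive dimension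
are sequences of bistellar moves. -/
theorem reflTransGen_of_stellarFaces (hn : Module.finrank ℝ E = n) (hn3 : n ≤ 3)
    (hK : K.faces.Finite) (hA : A ∈ K.faces) (hAc : 1 < A.card)
    (hstar : ∀ s ∈ K.faces, A ⊆ s → convexHull ℝ (s : Set E) ⊆ interior K.space)
    {α : E →₀ ℝ} {a : E} (hα : SuppIn α A) (hpos : ∀ v ∈ A, 0 < α v) (hb : bary α = (a, 1))
    (hL : L.faces = stellarFaces K.faces A a) : Relation.ReflTransGen (BistellarMove n) K L := by
  have hAne := K.nonempty_of_mem_faces hA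
  obtain ⟨x, hx⟩ := hAne
  have hint : IsInteriorFace K A := isInteriorFace_of_subset ⟨x, hx⟩ (convex_convexHull ℝ _)
    (subset_convexHull ℝ _) (hstar A hA (Finset.Subset.refl A))
  obtain ⟨b, hbT, ⟨P, hP, hAP, hPc, β, hβ, hβb, hβpos⟩, N, hN, hAN, hNc, γ, hγ, hγb, hγneg⟩ :=
    exists_generic_point hn hK hA hint hα hpos hb hx
  have ha : ∀ s ∈ K.faces, a ∉ s := notMem_of_pos hA hAc hα hpos hb
  have hbK : ∀ s ∈ K.faces, b ∉ s :=
    notMem_of_pos hP (hAc.trans_le (Finset.card_le_card hAP)) hβ hβpos hβb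
  obtain ⟨y₀, hy₀, hy₀x⟩ := Finset.exists_mem_ne hAc x
  have hab : a ≠ b := by
    rintro rfl
    have hβα : β = α := eq_of_bary_eq (K.indep hP) hβ (hα.mono hAP) (hβb.trans hb.symm)
    have h := (hbT P hP hAP hPc β hβ hβb).2.2.1 y₀ hy₀ hy₀x
    rw [hβα, div_self (hpos _ hy₀).ne', div_self (hpos x hx).ne'] at h
    exact lt_irrefl _ h
  have hex : ∀ T ∈ K.faces, A ⊆ T → T.card = n + 1 → ∃ β, SuppIn β T ∧ bary β = (b, 1) := by
    intro T hT hAT hTc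
    obtain ⟨B, hB⟩ := exists_weight_of_card (K.indep hT) (by rw [hTc, hn])
    exact ⟨_, hB (b, 1)⟩
  obtain ⟨K₁, hK₁, hK₁f⟩ := exists_stellar (p := b) hn hK (by omega) hA hint
    (fun T hT hAT hTc _ w hw hwb => by
      obtain ⟨h1, h2, -⟩ := hbT T hT hAT hTc w hw hwb
      refine ⟨fun v hv => ?_, h1⟩
      by_cases hvA : v ∈ A
      · exact (h1 v hvA).ne'
      · exact h2 v hv hvA)
    hP hAP hPc (hbK P hP) hβ hβb hβpos
  have hbP : b ∈ convexHull ℝ (P : Set E) :=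
    mem_convexHull_iff_bary.mpr ⟨β, hβ, wnonneg_of_pos hβ hβpos, hβb⟩
  have hcard : (insert b (A.erase x)).card = A.card := by
    rw [Finset.card_insert_of_notMem fun h => hbK A hA (Finset.mem_of_mem_erase h),
      Finset.card_erase_add_one hx]
  obtain ⟨K₂, hK₂, hK₂f⟩ := exists_stellar_of_stellarFaces (p := a) (B := insert b (A.erase x)) hn hK
    hK₁f ha hbK hab (hK₁f ▸ insert_erase_mem_stellarFaces hA (Finset.Subset.refl A) hx)
    (Finset.mem_insert_self _ _) (by omega)
    (isInteriorFace_of_subset (Finset.insert_nonempty _ _) (convex_convexHull ℝ (P : Set E))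
      (by
        rw [Finset.coe_insert, Set.insert_subset_iff]
        exact ⟨hbP, fun v hv => subset_convexHull ℝ _ (hAP (Finset.mem_of_mem_erase hv))⟩)
      (by rw [reflTransGen_space hK₁]; exact hstar P hP hAP))
    (fun T hT hAT hTc => by
      obtain ⟨g, hg, hgb⟩ := hex T hT hAT hTc
      obtain ⟨h1, h2, h3, -⟩ := hbT T hT hAT hTc g hg hgb
      refine ⟨α, g, hα.mono hAT, hb, hg, hgb, fun y hy => ⟨hpos y hy, h1 y hy⟩,
        fun y hy hsub v hv hvy => ?_⟩
      obtain rfl : y = x := by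
        by_contra hyx
        rcases Finset.mem_insert.mp
          (hsub (Finset.mem_insert_of_mem (Finset.mem_erase.mpr ⟨hyx, hy⟩))) with h | h
        · exact hbK A hA (h ▸ hy)
        · exact Finset.notMem_erase _ _ h
      by_cases hvA : v ∈ A
      · have h4 := h3 v hvA hvy
        have h5 : 0 < α v - α y / g y * g v := by
          rw [div_lt_div_iff₀ (hpos v hvA) (hpos y hy)] at h4
          rw [sub_pos, div_mul_eq_mul_div, div_lt_iff₀ (h1 y hy)]
          linarith
        exact ⟨h5.ne', fun _ => h5⟩
      · rw [hα v hvA, zero_sub]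
        refine ⟨neg_ne_zero.mpr (mul_ne_zero (div_pos (hpos y hy) (h1 y hy)).ne' (h2 v hv hvA)),
          fun hvB => ?_⟩
        rcases Finset.mem_insert.mp hvB with h | h
        · exact absurd hv (h ▸ hbK T hT)
        · exact absurd (Finset.mem_of_mem_erase h) hvA)
    (by
      obtain ⟨h1, h2, h3, -⟩ := hbT N hN hAN hNc γ hγ hγb
      refine ⟨N, hN, hAN, hNc, α, γ, hα.mono hAN, hb, hγ, hγb, x, hx, hpos x hx, h1 x hx,
        Finset.insert_subset_insert _ (Finset.erase_subset_erase _ hAN), fun v hv hvx => ?_⟩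
      by_cases hvA : v ∈ A
      · have h4 := h3 v hvA hvx
        rw [div_lt_div_iff₀ (hpos v hvA) (hpos x hx)] at h4
        rw [sub_pos, div_mul_eq_mul_div, div_lt_iff₀ (h1 x hx)]
        linarith
      · rw [hα v hvA, zero_sub]
        exact neg_pos.mpr (mul_neg_of_pos_of_neg (div_pos (hpos x hx) (h1 x hx))
          (hγneg v hv hvA)))
  have hxa : x ≠ a := fun h => ha A hA (h ▸ hx)
  have haA : a ∈ convexHull ℝ (A : Set E) :=
    mem_convexHull_iff_bary.mpr ⟨α, hα, wnonneg_of_pos hα hpos, hb⟩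
  obtain ⟨K₃, hK₃, hK₃f⟩ := exists_stellar_of_stellarFaces (p := b) (B := {x, a}) hn hK
    hL hbK ha hab.symm
    (by
      refine L.down_closed (hL ▸ insert_erase_mem_stellarFaces hA (Finset.Subset.refl A) hy₀)
        (fun v hv => ?_) (Finset.insert_nonempty _ _)
      rcases Finset.mem_insert.mp hv with rfl | hv
      · exact Finset.mem_insert_of_mem (Finset.mem_erase.mpr ⟨hy₀x.symm, hx⟩)
      · rw [Finset.mem_singleton.mp hv]
        exact Finset.mem_insert_self _ _)
    (by simp) (by rw [Finset.card_pair hxa]; omega)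
    (isInteriorFace_of_subset (Finset.insert_nonempty _ _) (convex_convexHull ℝ (A : Set E))
      (by
        rw [Finset.coe_insert, Finset.coe_singleton, Set.insert_subset_iff,
          Set.singleton_subset_iff]
        exact ⟨subset_convexHull ℝ _ hx, haA⟩)
      ((hstar A hA (Finset.Subset.refl A)).trans
        (interior_mono (space_subset_of_stellarFaces hL ⟨x, hx⟩ hα hpos hb))))
    (fun T hT hAT hTc => by
      obtain ⟨g, hg, hgb⟩ := hex T hT hAT hTc
      obtain ⟨h1, h2, h3, h4⟩ := hbT T hT hAT hTc g hg hgb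
      refine ⟨g, α, hg, hgb, hα.mono hAT, hb, fun y hy => ⟨h1 y hy, hpos y hy⟩,
        fun y hy hsub v hv hvy => ?_⟩
      by_cases hvA : v ∈ A
      · refine ⟨fun h => h4 v hvA y hy hvy ?_, fun hvB => ?_⟩
        · rw [div_eq_iff (hpos v hvA).ne']
          linarith
        · have hvx : v = x := by
            rcases Finset.mem_insert.mp hvB with h | h
            · exact h
            · exact absurd hvA (Finset.mem_singleton.mp h ▸ ha A hA)
          subst hvx
          have h5 := h3 y hy hvy.symm
          rw [lt_div_iff₀ (hpos v hx)] at h5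
          linarith
      · rw [hα v hvA, mul_zero, sub_zero]
        refine ⟨h2 v hv hvA, fun hvB => ?_⟩
        rcases Finset.mem_insert.mp hvB with h | h
        · exact absurd (h ▸ hx) hvA
        · exact absurd hv (Finset.mem_singleton.mp h ▸ ha T hT))
    (by
      obtain ⟨h1, h2, h3, h4⟩ := hbT P hP hAP hPc β hβ hβb
      obtain ⟨y, hy, hmin⟩ := A.exists_min_image (fun y => β y / α y) ⟨x, hx⟩
      have hyx : y ≠ x := by
        rintro rfl
        exact absurd (h3 y₀ hy₀ hy₀x) (not_lt.mpr (hmin y₀ hy₀))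
      refine ⟨P, hP, hAP, hPc, β, α, hβ, hβb, hα.mono hAP, hb, y, hy, h1 y hy, hpos y hy, ?_,
        fun v hv hvy => ?_⟩
      · intro v hv
        rcases Finset.mem_insert.mp hv with rfl | hv
        · exact Finset.mem_insert_of_mem (Finset.mem_erase.mpr ⟨hyx.symm, hAP hx⟩)
        · rw [Finset.mem_singleton.mp hv]
          exact Finset.mem_insert_self _ _
      · by_cases hvA : v ∈ A
        · have h5 := lt_of_le_of_ne (hmin v hvA) (h4 y hy v hvA hvy.symm)
          rw [lt_div_iff₀ (hpos v hvA)] at h5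
          linarith
        · rw [hα v hvA, mul_zero, sub_zero]
          exact hβpos v hv)
  have heq : K₂ = K₃ := by
    apply Geometry.SimplicialComplex.ext
    rw [hK₂f, hK₃f, hK₁f, hL]
    exact stellarFaces_comm hx hAc ha hbK hA
  subst heq
  have : Std.Symm (BistellarMove (E := E) n) := ⟨fun _ _ h => h.symm⟩
  exact (hK₁.trans hK₂).trans (Relation.ReflTransGen.stdSymm.symm _ _ hK₃)

end StellarSubdivision

section IntrinsicInterior

/-- A point in the intrinsic interior of a simplex has positive weights. -/
lemma exists_pos_weight_of_mem_intrinsicInterior {A : Finset E}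
    (hA : AffineIndependent ℝ ((↑) : A → E)) {a : E}
    (ha : a ∈ intrinsicInterior ℝ (convexHull ℝ (A : Set E))) :
    ∃ α : E →₀ ℝ, SuppIn α A ∧ (∀ v ∈ A, 0 < α v) ∧ bary α = (a, 1) := by
  obtain ⟨α, hα, hα0, hb⟩ := mem_convexHull_iff_bary.mp (intrinsicInterior_subset ha)
  refine ⟨α, hα, fun v hv => lt_of_le_of_ne (hα0 v) fun hv0 => ?_, hb⟩
  have hvA : v ∈ convexHull ℝ (A : Set E) := subset_convexHull ℝ _ hv
  obtain ⟨⟨a', ha'⟩, hint, rfl⟩ := mem_intrinsicInterior.mp ha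
  have hspan : ∀ t : ℝ, AffineMap.lineMap a' v t ∈ affineSpan ℝ (convexHull ℝ (A : Set E)) :=
    fun t => AffineMap.lineMap_mem t ha' (subset_affineSpan ℝ _ hvA)
  have hcont : Continuous fun t : ℝ =>
      (⟨AffineMap.lineMap a' v t, hspan t⟩ : affineSpan ℝ (convexHull ℝ (A : Set E))) :=
    AffineMap.lineMap_continuous.subtype_mk _
  have hev : ∀ᶠ t : ℝ in nhdsWithin 0 (Set.Iio 0),
      AffineMap.lineMap a' v t ∈ convexHull ℝ (A : Set E) := by
    refine nhdsWithin_le_nhds ?_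
    have h0 : (⟨AffineMap.lineMap a' v (0 : ℝ), hspan 0⟩ :
        affineSpan ℝ (convexHull ℝ (A : Set E))) = ⟨a', ha'⟩ :=
      Subtype.ext (AffineMap.lineMap_apply_zero _ _)
    have := hcont.tendsto 0
    rw [h0] at this
    exact this.eventually (mem_interior_iff_mem_nhds.mp hint)
  obtain ⟨t, ht, ht0⟩ := (hev.and self_mem_nhdsWithin).exists
  have ht0 : t < 0 := ht0
  obtain ⟨f, hf, hf0, hfb⟩ := mem_convexHull_iff_bary.mp ht
  have hfe : f = (1 - t) • α + Finsupp.single v t := by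
    refine eq_of_bary_eq hA hf (fun u hu => ?_) ?_
    · rw [Finsupp.add_apply, Finsupp.smul_apply, hα u hu, suppIn_single v t hv u hu]; simp
    · rw [hfb, map_add, map_smul, hb, bary_single, AffineMap.lineMap_apply_module]
      ext <;> simp
  have h1 := hf0 v
  rw [hfe, Finsupp.add_apply, Finsupp.smul_apply, ← hv0, Finsupp.single_eq_same] at h1
  simp at h1
  linarith

end IntrinsicInterior

/-- Stellar subdivision at a vertex does nothing. -/
lemma stellarFaces_singleton (F : Set (Finset E)) (a : E) : stellarFaces F {a} a = F := by
  ext s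
  constructor
  · rintro (⟨hs, -⟩ | ⟨A', C, hA', -, hC, rfl⟩)
    · exact hs
    · rwa [Finset.ssubset_singleton_iff.mp hA', Finset.empty_union, Finset.insert_eq]
  · intro hs
    by_cases h : {a} ⊆ s
    · refine Or.inr ⟨∅, s \ {a}, by simp, Finset.disjoint_sdiff, ?_, ?_⟩
      · rwa [Finset.union_sdiff_of_subset h]
      · rw [Finset.empty_union, Finset.insert_eq, Finset.union_sdiff_of_subset h]
    · exact Or.inl ⟨hs, h⟩

/-- Let `n ≤ 3`, let `K` be an `n`-dimensional geometric simplicial complex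
in `ℝⁿ`, let `A` be a simplex of `K` whose star is disjoint from the topological boundary of
`|K|` in `ℝⁿ`, and let `a` be a point in the (relative) interior of `A`. Then the stellar
subdivision `(A,a)K` is related to `K` by a finite sequence of geometric bistellar moves. -/
theorem statement12 {n : ℕ} (hn : n ≤ 3)
    (K : Geometry.SimplicialComplex ℝ (Fin n → ℝ)) (hKfin : K.faces.Finite)
    (hdim : ∀ s ∈ K.faces, s.card ≤ n + 1) (hdim' : ∃ s ∈ K.faces, s.card = n + 1)
    (A : Finset (Fin n → ℝ)) (hA : A ∈ K.faces)
    (hstar : Disjoint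
      (⋃ s ∈ {s ∈ K.faces | ∃ t ∈ K.faces, A ⊆ t ∧ s ⊆ t},
        convexHull ℝ (s : Set (Fin n → ℝ)))
      (frontier K.space))
    (a : Fin n → ℝ) (ha : a ∈ intrinsicInterior ℝ (convexHull ℝ (A : Set (Fin n → ℝ))))
    (K' : Geometry.SimplicialComplex ℝ (Fin n → ℝ))
    (hK' : K'.faces = (K.faces \ {s | A ⊆ s}) ∪
      {s | ∃ A' C : Finset (Fin n → ℝ), A' ⊂ A ∧ Disjoint A C ∧ A ∪ C ∈ K.faces ∧
        s = insert a (A' ∪ C)}) :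
    Relation.ReflTransGen (BistellarMove n) K K' := by
  have hK'' : K'.faces = stellarFaces K.faces A a := by
    rw [hK', stellarFaces]
    convert rfl
  have hsub : ∀ s ∈ K.faces, A ⊆ s →
      convexHull ℝ (s : Set (Fin n → ℝ)) ⊆ interior K.space := by
    intro s hs hAs z hz
    have hzK : z ∈ K.space := Geometry.SimplicialComplex.mem_space_iff.mpr ⟨s, hs, hz⟩
    have hzf : z ∉ frontier K.space := Set.disjoint_left.mp hstar
      (Set.mem_biUnion (show s ∈ {s ∈ K.faces | ∃ t ∈ K.faces, A ⊆ t ∧ s ⊆ t} from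
        ⟨hs, s, hs, hAs, Finset.Subset.refl s⟩) hz)
    by_contra h
    exact hzf ⟨subset_closure hzK, h⟩
  obtain ⟨α, hα, hpos, hb⟩ := exists_pos_weight_of_mem_intrinsicInterior (K.indep hA) ha
  rcases Nat.lt_or_ge 1 A.card with hc | hc
  · exact reflTransGen_of_stellarFaces (by simp) hn hKfin hA hc hsub hα hpos hb hK''
  · obtain ⟨v, rfl⟩ := Finset.card_eq_one.mp
      (le_antisymm hc (K.nonempty_of_mem_faces hA).card_pos)
    obtain rfl : a = v := by
      have := intrinsicInterior_subset ha
      simpa using this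
    obtain rfl : K' = K := by
      apply Geometry.SimplicialComplex.ext
      rw [hK'', stellarFaces_singleton]
    exact Relation.ReflTransGen.refl
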